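/- arXiv:1610.06509 — 4 statements merged into one kernel-verified Lean document; each statement's English description precedes it below -/
import Mathlib

section
/- Let R be an associative unital ring and let (𝒯,ℱ) be a torsion pair in the category R-Mod of left R-modules. Then the Happel–Reiten–Smalø t-structure associated to (𝒯,ℱ) on the unbounded derived category D(R) is compactly generated if and only if there exists a set {T_λ}_{λ∈Λ} of finitely presented left R-modules with T_λ ∈ 𝒯 for every λ such that ℱ = {M ∈ R-Mod : Hom_R(T_λ, M) = 0 for all λ ∈ Λ}. -/
open CategoryTheory Limits DirectSum

universe w u

variable (R : Type u) [Ring R] [HasDerivedCategory.{w} (ModuleCat.{u} R)]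

/-- A torsion pair `(T, F)` in the category of left `R`-modules: both classes are closed
under isomorphism, all homomorphisms from `T` to `F` vanish, and every module has a
torsion submodule in `T` with torsion-free quotient in `F`. -/
structure ModTorsionPair (T F : ModuleCat.{u} R → Prop) : Prop where
  iso_closed_torsion : ∀ {M N : ModuleCat.{u} R}, (M ≅ N) → T M → T N
  iso_closed_torsionfree : ∀ {M N : ModuleCat.{u} R}, (M ≅ N) → F M → F N
  hom_eq_zero : ∀ {M N : ModuleCat.{u} R}, T M → F N → ∀ f : M →ₗ[R] N, f = 0
  exists_torsion_submodule : ∀ M : ModuleCat.{u} R, ∃ t : Submodule R M,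
    T (ModuleCat.of R t) ∧ F (ModuleCat.of R (M ⧸ t))

/-- An object `S` of a preadditive category is compact when, for every family `(Y i)`
admitting a coproduct, the canonical map `⨁ᵢ Hom(S, Y i) → Hom(S, ∐ Y)` is bijective. -/
def IsCompactObject {D : Type*} [Category D] [Preadditive D] (S : D) : Prop :=
  ∀ (I : Type w) [DecidableEq I] (Y : I → D) (c : Cofan Y), IsColimit c →
    Function.Bijective
      (DirectSum.toAddMonoid (fun i => Preadditive.rightComp S (c.inj i)) :
        (⨁ i, (S ⟶ Y i)) →+ (S ⟶ c.pt))

/-- The aisle of the Happel-Reiten-Smalø t-structure attached to a torsion class `T`: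
complexes `X` with `H^k X = 0` for all `k > 0` and `H^0 X ∈ T`. -/
def HRSAisle (T : ModuleCat.{u} R → Prop) : Set (DerivedCategory (ModuleCat.{u} R)) :=
  {X | (∀ k : ℤ, 0 < k →
      IsZero ((DerivedCategory.homologyFunctor (ModuleCat.{u} R) k).obj X)) ∧
    T ((DerivedCategory.homologyFunctor (ModuleCat.{u} R) 0).obj X)}

/-- The right orthogonal of a class of objects of the derived category. -/
def rightPerp (U : Set (DerivedCategory (ModuleCat.{u} R))) :
    Set (DerivedCategory (ModuleCat.{u} R)) :=
  {Y | ∀ X ∈ U, ∀ f : X ⟶ Y, f = 0}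

/-- The Happel-Reiten-Smalø t-structure attached to the torsion class `T` is compactly
generated: there is a set `S` of compact objects contained in the aisle such that the
objects of the co-aisle (shifted by one) are exactly those `Y` with
`Hom(s⟦n⟧, Y) = 0` for all `s ∈ S` and all `n ≥ 0`. -/
def HRSCompactlyGenerated (T : ModuleCat.{u} R → Prop) : Prop :=
  ∃ S : Set (DerivedCategory (ModuleCat.{u} R)),
    (∀ s ∈ S, IsCompactObject.{w} s) ∧ (∀ s ∈ S, s ∈ HRSAisle R T) ∧
    ∀ Y : DerivedCategory (ModuleCat.{u} R),
      Y ∈ rightPerp R (HRSAisle R T) ↔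
        ∀ s ∈ S, ∀ n : ℤ, 0 ≤ n →
          ∀ f : (s⟦n⟧ : DerivedCategory (ModuleCat.{u} R)) ⟶ Y, f = 0

namespace IsCompactObject

section

variable {D : Type*} [Category D] [Preadditive D]

/-- The morphisms into the point of a cofan which factor through finitely many summands. -/
def cofanRange {I : Type w} {Y : I → D} (c : Cofan Y) (S : D) : AddSubgroup (S ⟶ c.pt) :=
  AddSubgroup.closure {f | ∃ (i : I) (a : S ⟶ Y i), f = a ≫ c.inj i}

lemma comp_inj_mem_cofanRange {I : Type w} {Y : I → D} (c : Cofan Y) {S : D} (i : I)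
    (a : S ⟶ Y i) : a ≫ c.inj i ∈ cofanRange c S :=
  AddSubgroup.subset_closure ⟨i, a, rfl⟩

lemma comp_mem_cofanRange {I : Type w} {Y : I → D} (c : Cofan Y) {S S' : D} (g : S' ⟶ S)
    {f : S ⟶ c.pt} (hf : f ∈ cofanRange c S) : g ≫ f ∈ cofanRange c S' := by
  refine AddSubgroup.closure_induction (p := fun f _ ↦ g ≫ f ∈ cofanRange c S') ?_ ?_ ?_ ?_ hf
  · rintro _ ⟨i, a, rfl⟩
    rw [← Category.assoc]
    exact comp_inj_mem_cofanRange c i _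
  · simp
  · intro x y _ _ hx hy
    rw [Preadditive.comp_add]
    exact add_mem hx hy
  · intro x _ hx
    rw [Preadditive.comp_neg]
    exact neg_mem hx

lemma mem_cofanRange_iff {I : Type w} [DecidableEq I] {Y : I → D} (c : Cofan Y) {S : D}
    (f : S ⟶ c.pt) : f ∈ cofanRange c S ↔ f ∈ (DirectSum.toAddMonoid
      (fun i => Preadditive.rightComp S (c.inj i)) : (⨁ i, (S ⟶ Y i)) →+ (S ⟶ c.pt)).range := by
  constructor
  · intro h
    refine (AddSubgroup.closure_le _).2 ?_ h
    rintro _ ⟨i, a, rfl⟩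
    exact ⟨DirectSum.of _ i a, by simp [Preadditive.rightComp]⟩
  · rintro ⟨x, rfl⟩
    induction x using DirectSum.induction_on with
    | zero => simp
    | of i a =>
      rw [DirectSum.toAddMonoid_of]
      exact comp_inj_mem_cofanRange c i a
    | add x y hx hy => rw [map_add]; exact add_mem hx hy

/-- The canonical map from a direct sum of groups of morphisms to the group of morphisms into a
coproduct is always injective. -/
lemma toAddMonoid_injective {I : Type w} [DecidableEq I] {Y : I → D} {c : Cofan Y}
    (hc : IsColimit c) (S : D) : Function.Injective (DirectSum.toAddMonoid
      (fun i => Preadditive.rightComp S (c.inj i)) : (⨁ i, (S ⟶ Y i)) →+ (S ⟶ c.pt)) := by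
  rw [injective_iff_map_eq_zero]
  intro x hx
  ext i
  let p : c.pt ⟶ Y i := Cofan.IsColimit.desc hc
    (fun j ↦ if h : j = i then eqToHom (by rw [h]) else 0)
  have key : ∀ x : ⨁ i, (S ⟶ Y i), (DirectSum.toAddMonoid
      (fun i => Preadditive.rightComp S (c.inj i)) : (⨁ i, (S ⟶ Y i)) →+ (S ⟶ c.pt)) x ≫ p
        = x i := by
    intro x
    induction x using DirectSum.induction_on with
    | zero => simp
    | of j a =>
      rw [DirectSum.toAddMonoid_of]
      change (a ≫ c.inj j) ≫ p = _
      rw [Category.assoc, Cofan.IsColimit.fac]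
      by_cases h : j = i
      · subst h
        simp
      · rw [dif_neg h, comp_zero, DirectSum.of_eq_of_ne _ _ _ (Ne.symm h)]
    | add x y hx hy =>
      rw [map_add, Preadditive.add_comp, hx, hy, DirectSum.add_apply]
  rw [← key x, hx, zero_comp, DirectSum.zero_apply]

lemma iff_cofanRange {S : D} : IsCompactObject.{w} S ↔
    ∀ (I : Type w) (Y : I → D) (c : Cofan Y), IsColimit c →
      ∀ f : S ⟶ c.pt, f ∈ cofanRange c S := by
  classical
  constructor
  · intro h I Y c hc f
    exact (mem_cofanRange_iff c f).2 ((h I Y c hc).2 f)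
  · intro h I _ Y c hc
    exact ⟨toAddMonoid_injective hc S, fun f ↦ (mem_cofanRange_iff c f).1 (h I Y c hc f)⟩

/-- A retract of a compact object is compact. -/
lemma of_retract {S S' : D} (h : IsCompactObject.{w} S) (i : S' ⟶ S) (r : S ⟶ S')
    (hir : i ≫ r = 𝟙 S') : IsCompactObject.{w} S' := by
  rw [iff_cofanRange] at h ⊢
  intro I Y c hc f
  have := comp_mem_cofanRange c i (h I Y c hc (r ≫ f))
  rwa [← Category.assoc, hir, Category.id_comp] at this

lemma of_iso {S S' : D} (h : IsCompactObject.{w} S) (e : S ≅ S') : IsCompactObject.{w} S' :=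
  h.of_retract e.inv e.hom (by simp)

/-- An object whose identity is a finite sum of morphisms factoring through compact objects is
compact. -/
lemma of_sum {S : D} {ι : Type*} (s : Finset ι) (Z : ι → D) (hZ : ∀ i, IsCompactObject.{w} (Z i))
    (p : ∀ i, S ⟶ Z i) (q : ∀ i, Z i ⟶ S) (h : ∑ i ∈ s, p i ≫ q i = 𝟙 S) :
    IsCompactObject.{w} S := by
  rw [iff_cofanRange]
  intro I Y c hc f
  rw [← Category.id_comp f, ← h, Preadditive.sum_comp]
  refine sum_mem fun i _ ↦ ?_
  rw [Category.assoc]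
  exact comp_mem_cofanRange c _ (iff_cofanRange.1 (hZ i) I Y c hc _)

/-- A morphism from a compact object to a coproduct factors through finitely many summands:
it is killed by all but finitely many projections. -/
lemma exists_finset {S : D} (h : IsCompactObject.{w} S) {I : Type w} {Y : I → D} {c : Cofan Y}
    (hc : IsColimit c) (f : S ⟶ c.pt) : ∃ (s : Finset I) (a : ∀ i, S ⟶ Y i),
      f = ∑ i ∈ s, a i ≫ c.inj i := by
  classical
  obtain ⟨x, rfl⟩ := (h I Y c hc).2 f
  refine ⟨DFinsupp.support x, fun i ↦ x i, ?_⟩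
  exact DFinsupp.sumAddHom_apply _ x

end

section Pretriangulated

open Pretriangulated

variable {D : Type*} [Category D] [Preadditive D] [HasZeroObject D] [HasShift D ℤ]
  [∀ n : ℤ, (shiftFunctor D n).Additive] [Pretriangulated D]

/-- Compact objects are closed under extensions. -/
lemma of_distTriang (T : Triangle D) (hT : T ∈ distTriang D) (h₁ : IsCompactObject.{w} T.obj₁)
    (h₃ : IsCompactObject.{w} T.obj₃) : IsCompactObject.{w} T.obj₂ := by
  classical
  rw [iff_cofanRange]
  intro I Y c hc f
  obtain ⟨s, a, ha⟩ := h₁.exists_finset hc (T.mor₁ ≫ f)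
  let p : ∀ i, c.pt ⟶ Y i := fun i ↦ Cofan.IsColimit.desc hc
    (fun j ↦ if h : j = i then eqToHom (by rw [h]) else 0)
  have hp : ∀ i, c.inj i ≫ p i = 𝟙 _ := fun i ↦ by simp [p, Cofan.IsColimit.fac]
  have hp' : ∀ i j, j ≠ i → c.inj j ≫ p i = 0 := fun i j h ↦ by
    simp [p, Cofan.IsColimit.fac, h]
  let g : T.obj₂ ⟶ c.pt := ∑ i ∈ s, (f ≫ p i) ≫ c.inj i
  have hg : T.mor₁ ≫ (f - g) = 0 := by
    rw [Preadditive.comp_sub, sub_eq_zero, Preadditive.comp_sum, ha]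
    refine Finset.sum_congr rfl fun i hi ↦ ?_
    rw [← Category.assoc, ← Category.assoc, ha, Preadditive.sum_comp,
      Finset.sum_eq_single_of_mem i hi]
    · simp only [Category.assoc, reassoc_of% (hp i)]
    · intro j _ hj
      rw [Category.assoc, hp' i j hj, comp_zero]
  obtain ⟨k, hk⟩ := Triangle.yoneda_exact₂ T hT _ hg
  have : f = g + T.mor₂ ≫ k := by rw [← hk]; abel
  rw [this]
  refine add_mem (sum_mem fun i _ ↦ comp_inj_mem_cofanRange c i _) ?_
  exact comp_mem_cofanRange c _ (iff_cofanRange.1 h₃ I Y c hc k)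

lemma biprod {A B : D} (hA : IsCompactObject.{w} A) (hB : IsCompactObject.{w} B) :
    IsCompactObject.{w} (A ⊞ B) :=
  of_distTriang _ (binaryBiproductTriangle_distinguished A B) hA hB

end Pretriangulated

end IsCompactObject

namespace CategoryTheory.Pretriangulated

section

variable {D : Type*} [Category D] [Preadditive D] [HasZeroObject D] [HasShift D ℤ]
  [∀ n : ℤ, (shiftFunctor D n).Additive] [Pretriangulated D] {X Y Z : D}
  {f : X ⟶ Y} {g : Y ⟶ Z} {h : Z ⟶ X⟦(1 : ℤ)⟧}

lemma mk_distinguished_of_iso₃ (hT : Triangle.mk f g h ∈ distTriang D) {Z' : D} (e : Z ≅ Z') :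
    Triangle.mk f (g ≫ e.hom) (e.inv ≫ h) ∈ distTriang D :=
  isomorphic_distinguished _ hT _ (Triangle.isoMk _ _ (Iso.refl X) (Iso.refl Y) e.symm
    ((Category.comp_id f).trans (Category.id_comp f).symm)
    (by change (g ≫ e.hom) ≫ e.inv = 𝟙 Y ≫ g; simp)
    (by change (e.inv ≫ h) ≫ (𝟙 X)⟦(1 : ℤ)⟧' = e.inv ≫ h; simp))

lemma mk_distinguished_of_iso₁ (hT : Triangle.mk f g h ∈ distTriang D) {X' : D} (e : X ≅ X') :
    Triangle.mk (e.inv ≫ f) g (h ≫ e.hom⟦(1 : ℤ)⟧') ∈ distTriang D :=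
  isomorphic_distinguished _ hT _ (Triangle.isoMk _ _ e.symm (Iso.refl Y) (Iso.refl Z)
    (Category.comp_id _)
    ((Category.comp_id g).trans (Category.id_comp g).symm)
    (by
      change (h ≫ e.hom⟦(1 : ℤ)⟧') ≫ e.inv⟦(1 : ℤ)⟧' = 𝟙 Z ≫ h
      rw [Category.assoc, ← Functor.map_comp, e.hom_inv_id, Functor.map_id, Category.comp_id,
        Category.id_comp]))

lemma exists_mor₂_comp_eq (hT : Triangle.mk f g h ∈ distTriang D) {W : D} (a : Y ⟶ W)
    (ha : f ≫ a = 0) : ∃ b : Z ⟶ W, a = g ≫ b :=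
  Triangle.yoneda_exact₂ _ hT a ha

lemma exists_comp_mor₁_eq (hT : Triangle.mk f g h ∈ distTriang D) {W : D} (a : W ⟶ Y)
    (ha : a ≫ g = 0) : ∃ b : W ⟶ X, a = b ≫ f :=
  Triangle.coyoneda_exact₂ _ hT a ha

lemma exists_comp_mor₂_eq (hT : Triangle.mk f g h ∈ distTriang D) {W : D} (a : W ⟶ Z)
    (ha : a ≫ h = 0) : ∃ b : W ⟶ Y, a = b ≫ g :=
  Triangle.coyoneda_exact₃ _ hT a ha

end

end CategoryTheory.Pretriangulated

namespace DerivedCategory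

open Pretriangulated HomologySequence

variable {C : Type*} [Category C] [Abelian C] [HasDerivedCategory C]

lemma singleFunctor_hom_eq_zero {M N : C} {n : ℤ}
    (f : (singleFunctor C n).obj M ⟶ (singleFunctor C n).obj N)
    (hf : (homologyFunctor C n).map f = 0) : f = 0 := by
  obtain ⟨f, rfl⟩ := (singleFunctor C n).map_surjective f
  have := (singleFunctorCompHomologyFunctorIso C n).hom.naturality f
  dsimp at this
  rw [hf, zero_comp] at this
  have h0 : f = 0 := by
    rw [← cancel_epi ((singleFunctorCompHomologyFunctorIso C n).hom.app M), ← this, comp_zero]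
  rw [h0, Functor.map_zero]

lemma exists_singleFunctor_hom {M N : C} {n : ℤ}
    (g : (homologyFunctor C n).obj ((singleFunctor C n).obj M) ⟶
      (homologyFunctor C n).obj ((singleFunctor C n).obj N)) :
    ∃ f, (homologyFunctor C n).map f = g := by
  let e := singleFunctorCompHomologyFunctorIso C n
  refine ⟨(singleFunctor C n).map (e.inv.app M ≫ g ≫ e.hom.app N), ?_⟩
  have := e.hom.naturality (e.inv.app M ≫ g ≫ e.hom.app N)
  dsimp at this
  rw [← cancel_mono (e.hom.app N), this]
  simp

/-- The truncation triangle of an object cohomologically concentrated in degrees `≤ n`. -/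
lemma exists_triangle_to_single (X : DerivedCategory C) (n m : ℤ) (hm : m + 1 = n) [X.IsLE n] :
    ∃ (A : DerivedCategory C) (_ : A.IsLE m) (N : C) (a : A ⟶ X)
      (p : X ⟶ (singleFunctor C n).obj N) (d : (singleFunctor C n).obj N ⟶ A⟦(1 : ℤ)⟧),
      Triangle.mk a p d ∈ distTriang _ ∧ IsIso ((homologyFunctor C n).map p) := by
  obtain ⟨A, B, hA, hB, a, p, d, hT⟩ := TStructure.t.exists_triangle X m n hm
  have hA' : A.IsLE m := ⟨hA⟩
  have hB' : B.IsGE n := ⟨hB⟩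
  have hB'' : B.IsLE n := by
    rw [isLE_iff]
    intro i hi
    refine (exact₃ _ hT i (i + 1)).isZero_X₂ ?_ ?_
    · exact (X.isZero_of_isLE n i hi).eq_of_src _ _
    · exact (A.isZero_of_isLE m (i + 1) (by lia)).eq_of_tgt _ _
  obtain ⟨N, ⟨e⟩⟩ := exists_iso_singleFunctor_obj_of_isGE_of_isLE B n
  refine ⟨A, hA', N, a, p ≫ e.hom, e.inv ≫ d,
    mk_distinguished_of_iso₃ hT e, ?_⟩
  rw [Functor.map_comp]
  have : IsIso ((homologyFunctor C n).map p) := by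
    have h1 : Mono ((homologyFunctor C n).map p) :=
      (mono_homologyMap_mor₂_iff _ hT n).2 ((A.isZero_of_isLE m n (by lia)).eq_of_src _ _)
    have h2 : Epi ((homologyFunctor C n).map p) :=
      (epi_homologyMap_mor₂_iff _ hT n (n + 1)).2
        ((A.isZero_of_isLE m (n + 1) (by lia)).eq_of_tgt _ _)
    exact isIso_of_mono_of_epi _
  infer_instance

/-- The truncation triangle of an object cohomologically concentrated in degrees `≥ n`. -/
lemma exists_triangle_from_single (Y : DerivedCategory C) (n m : ℤ) (hm : n + 1 = m) [Y.IsGE n] :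
    ∃ (B : DerivedCategory C) (_ : B.IsGE m) (N : C) (i : (singleFunctor C n).obj N ⟶ Y)
      (b : Y ⟶ B) (d : B ⟶ ((singleFunctor C n).obj N)⟦(1 : ℤ)⟧),
      Triangle.mk i b d ∈ distTriang _ ∧ IsIso ((homologyFunctor C n).map i) := by
  obtain ⟨A, B, hA, hB, a, p, d, hT⟩ := TStructure.t.exists_triangle Y n m hm
  have hA' : A.IsLE n := ⟨hA⟩
  have hB' : B.IsGE m := ⟨hB⟩
  have hA'' : A.IsGE n := by
    rw [isGE_iff]
    intro i hi
    refine (exact₁ _ hT (i - 1) i).isZero_X₂ ?_ ?_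
    · exact (B.isZero_of_isGE m (i - 1) (by lia)).eq_of_src _ _
    · exact (Y.isZero_of_isGE n i hi).eq_of_tgt _ _
  obtain ⟨N, ⟨e⟩⟩ := exists_iso_singleFunctor_obj_of_isGE_of_isLE A n
  refine ⟨B, hB', N, e.inv ≫ a, p, d ≫ e.hom⟦1⟧',
    mk_distinguished_of_iso₁ hT e, ?_⟩
  rw [Functor.map_comp]
  have : IsIso ((homologyFunctor C n).map a) := by
    have h1 : Mono ((homologyFunctor C n).map a) :=
      (mono_homologyMap_mor₁_iff _ hT (n - 1) n).2
        ((B.isZero_of_isGE m (n - 1) (by lia)).eq_of_src _ _)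
    have h2 : Epi ((homologyFunctor C n).map a) :=
      (epi_homologyMap_mor₁_iff _ hT n).2
        ((B.isZero_of_isGE m n (by lia)).eq_of_tgt _ _)
    exact isIso_of_mono_of_epi _
  infer_instance

section

variable {X Y : DerivedCategory C} (n : ℤ) [X.IsLE n] [Y.IsGE n]

/-- Morphisms from an object in degrees `≤ n` to an object in degrees `≥ n` are detected on
`H^n`. -/
lemma hom_eq_zero_of_homologyFunctor_map_eq_zero (f : X ⟶ Y)
    (hf : (homologyFunctor C n).map f = 0) : f = 0 := by
  obtain ⟨A, _, N, a, p, d, hT, _⟩ := exists_triangle_to_single X n (n - 1) (by lia)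
  obtain ⟨B, _, N', i, b, d', hT', _⟩ := exists_triangle_from_single Y n (n + 1) rfl
  obtain ⟨g, rfl⟩ := exists_mor₂_comp_eq hT f
    (TStructure.t.zero _ (n - 1) n (by lia))
  obtain ⟨h, rfl⟩ := exists_comp_mor₁_eq hT' g
    (TStructure.t.zero _ n (n + 1) (by lia))
  rw [Functor.map_comp, Functor.map_comp] at hf
  rw [singleFunctor_hom_eq_zero h, zero_comp, comp_zero]
  rw [← cancel_mono ((homologyFunctor C n).map i), ← cancel_epi ((homologyFunctor C n).map p), hf]
  simp

lemma homologyFunctor_map_surjective_of_isLE_of_isGE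
    (g : (homologyFunctor C n).obj X ⟶ (homologyFunctor C n).obj Y) :
    ∃ f : X ⟶ Y, (homologyFunctor C n).map f = g := by
  obtain ⟨A, _, N, a, p, d, hT, _⟩ := exists_triangle_to_single X n (n - 1) (by lia)
  obtain ⟨B, _, N', i, b, d', hT', _⟩ := exists_triangle_from_single Y n (n + 1) rfl
  obtain ⟨f, hf⟩ := exists_singleFunctor_hom (n := n) (inv ((homologyFunctor C n).map p) ≫ g ≫
    inv ((homologyFunctor C n).map i))
  exact ⟨p ≫ f ≫ i, by simp [hf]⟩

end

end DerivedCategory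

namespace CategoryTheory.Limits.Cofan.IsColimit

variable {C : Type*} [Category C] {J : Type*} {X : J → C} {P : C} {ι : ∀ j, X j ⟶ P}

lemma mk_hom_ext (h : IsColimit (Cofan.mk P ι)) {Z : C} {f g : P ⟶ Z}
    (H : ∀ j, ι j ≫ f = ι j ≫ g) : f = g :=
  Cofan.IsColimit.hom_ext h _ _ H

/-- The morphism from the point of an explicit coproduct cofan. -/
def mkDesc (h : IsColimit (Cofan.mk P ι)) {Z : C} (φ : ∀ j, X j ⟶ Z) : P ⟶ Z :=
  Cofan.IsColimit.desc h φ

lemma ι_mkDesc (h : IsColimit (Cofan.mk P ι)) {Z : C} (φ : ∀ j, X j ⟶ Z) (j : J) :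
    ι j ≫ mkDesc h φ = φ j :=
  Cofan.IsColimit.fac h φ j

lemma nonempty_of_existsUnique (h : ∀ (Z : C) (φ : ∀ j, X j ⟶ Z), ∃ g : P ⟶ Z, ∀ j, ι j ≫ g = φ j)
    (h' : ∀ (Z : C) (f g : P ⟶ Z), (∀ j, ι j ≫ f = ι j ≫ g) → f = g) :
    Nonempty (IsColimit (Cofan.mk P ι)) :=
  ⟨Cofan.IsColimit.mk _ (fun t ↦ (h t.pt t.inj).choose) (fun t ↦ (h t.pt t.inj).choose_spec)
    (fun t _ hm ↦ h' _ _ _ fun j ↦ (hm j).trans ((h t.pt t.inj).choose_spec j).symm)⟩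

lemma nonempty_reindex (h : IsColimit (Cofan.mk P ι)) {J' : Type*} (e : J' ≃ J) :
    Nonempty (IsColimit (Cofan.mk P (fun j ↦ ι (e j)))) := by
  refine nonempty_of_existsUnique (fun Z φ ↦ ⟨mkDesc h (fun j ↦ eqToHom (by simp) ≫
    φ (e.symm j)), fun j ↦ ?_⟩) (fun Z f g H ↦ mk_hom_ext h fun j ↦ ?_)
  · rw [ι_mkDesc]
    have : ∀ (k : J') (hk : k = j), eqToHom (by rw [hk]) ≫ φ k = φ j := by
      rintro k rfl
      simp
    exact this _ (by simp)
  · have := H (e.symm j)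
    have h2 : ∀ (k : J) (_ : k = j), ι k ≫ f = ι k ≫ g → ι j ≫ f = ι j ≫ g := by
      rintro k rfl
      exact id
    exact h2 _ (by simp) this

end CategoryTheory.Limits.Cofan.IsColimit

namespace DerivedCategory

open Pretriangulated HomologySequence

variable {C : Type*} [Category C] [Abelian C]

section

variable [HasDerivedCategory C]

lemma Q_map_surjective_of_isKProjective {K L : CochainComplex C ℤ} [K.IsKProjective]
    (f : Q.obj K ⟶ Q.obj L) : ∃ g : K ⟶ L, Q.map g = f := by
  obtain ⟨g, hg⟩ := (CochainComplex.IsKProjective.Qh_map_bijective K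
    ((HomotopyCategory.quotient _ _).obj L)).2
      ((quotientCompQhIso C).hom.app K ≫ f ≫ (quotientCompQhIso C).inv.app L)
  obtain ⟨g, rfl⟩ := (HomotopyCategory.quotient _ _).map_surjective g
  refine ⟨g, ?_⟩
  rw [← cancel_epi ((quotientCompQhIso C).hom.app K), ← quotientCompQhIso_hom_naturality, hg]
  simp

lemma nonempty_homotopy_of_isKProjective {K L : CochainComplex C ℤ} [K.IsKProjective]
    {f g : K ⟶ L} (h : Q.map f = Q.map g) : Nonempty (Homotopy f g) := by
  refine ⟨HomotopyCategory.homotopyOfEq _ _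
    ((CochainComplex.IsKProjective.Qh_map_bijective K _).1 ?_)⟩
  rw [← cancel_mono ((quotientCompQhIso C).hom.app L), quotientCompQhIso_hom_naturality,
    quotientCompQhIso_hom_naturality, h]

end

section coproduct

open Cofan.IsColimit

variable {J : Type*} {K : J → CochainComplex C ℤ} {P : CochainComplex C ℤ} (ι : ∀ j, K j ⟶ P)
  (h : ∀ k, IsColimit (Cofan.mk (P.X k) (fun j ↦ (ι j).f k)))

/-- Homotopies on the summands of a degreewise coproduct of complexes glue. -/
def homotopyOfCoproduct {L : CochainComplex C ℤ} {f : P ⟶ L} (H : ∀ j, Homotopy (ι j ≫ f) 0) :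
    Homotopy f 0 where
  hom i i' := mkDesc (h i) (fun j ↦ (H j).hom i i')
  zero i i' hi := mk_hom_ext (h i) fun j ↦ by
    rw [ι_mkDesc (ι := fun j ↦ (ι j).f i), (H j).zero i i' hi, comp_zero]
  comm i := mk_hom_ext (h i) fun j ↦ by
    have h1 := (H j).comm i
    rw [dNext_eq _ (show (ComplexShape.up ℤ).Rel i (i + 1) by simp),
      prevD_eq _ (show (ComplexShape.up ℤ).Rel (i - 1) i by simp)] at h1 ⊢
    rw [HomologicalComplex.comp_f] at h1
    have e₁ := ι_mkDesc (h i) (fun j ↦ (H j).hom i (i - 1)) j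
    have e₂ := ι_mkDesc (h (i + 1)) (fun j ↦ (H j).hom (i + 1) i) j
    rw [h1]
    simp only [Preadditive.comp_add, HomologicalComplex.zero_f, add_zero, reassoc_of% e₁]
    rw [← e₂, HomologicalComplex.Hom.comm_assoc]

/-- Chain maps on the summands of a degreewise coproduct of complexes glue. -/
def descOfCoproduct {L : CochainComplex C ℤ} (g : ∀ j, K j ⟶ L) : P ⟶ L where
  f i := mkDesc (h i) (fun j ↦ (g j).f i)
  comm' i i' _ := mk_hom_ext (h i) fun j ↦ by
    have e₁ := ι_mkDesc (h i) (fun j ↦ (g j).f i) j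
    have e₂ := ι_mkDesc (h i') (fun j ↦ (g j).f i') j
    rw [reassoc_of% e₁, HomologicalComplex.Hom.comm, ← e₂, HomologicalComplex.Hom.comm_assoc]

lemma ι_descOfCoproduct {L : CochainComplex C ℤ} (g : ∀ j, K j ⟶ L) (j : J) :
    ι j ≫ descOfCoproduct ι h g = g j := by
  ext i
  exact ι_mkDesc (h i) _ j

lemma isKProjective_of_coproduct
    (h : ∀ k, IsColimit (Cofan.mk (P.X k) (fun j ↦ (ι j).f k)))
    [∀ j, (K j).IsKProjective] : P.IsKProjective where
  nonempty_homotopy_zero f hL := ⟨homotopyOfCoproduct ι h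
    fun j ↦ (CochainComplex.IsKProjective.nonempty_homotopy_zero (ι j ≫ f) hL).some⟩

/-- Degreewise coproducts of K-projective complexes are coproducts in the derived category. -/
lemma nonempty_isColimit_Q_of_coproduct
    (h : ∀ k, IsColimit (Cofan.mk (P.X k) (fun j ↦ (ι j).f k)))
    [HasDerivedCategory C] [∀ j, (K j).IsKProjective] :
    Nonempty (IsColimit (Cofan.mk (Q.obj P) (fun j ↦ Q.map (ι j)))) := by
  have := isKProjective_of_coproduct ι h
  refine nonempty_of_existsUnique (fun Z φ ↦ ?_) (fun Z f g H ↦ ?_)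
  · choose g hg using fun j ↦ Q_map_surjective_of_isKProjective
      (φ j ≫ (Q.objObjPreimageIso Z).inv)
    refine ⟨Q.map (descOfCoproduct ι h g) ≫ (Q.objObjPreimageIso Z).hom, fun j ↦ ?_⟩
    rw [← Functor.map_comp_assoc, ι_descOfCoproduct, hg]
    simp
  · rw [← sub_eq_zero, ← cancel_mono (Q.objObjPreimageIso Z).inv, zero_comp]
    obtain ⟨d, hd⟩ := Q_map_surjective_of_isKProjective ((f - g) ≫ (Q.objObjPreimageIso Z).inv)
    rw [← hd, ← Q.map_zero]
    refine Q_map_eq_of_homotopy _ (homotopyOfCoproduct ι h fun j ↦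
      (nonempty_homotopy_of_isKProjective ?_).some)
    rw [Q.map_comp, hd, Q.map_zero, Preadditive.sub_comp, Preadditive.comp_sub,
      reassoc_of% (H j), sub_self]

end coproduct

end DerivedCategory

namespace ModuleCat

variable {R : Type u} [Ring R]

/-- Every element of a coproduct of modules is the sum of finitely many of its components. -/
lemma exists_finset_sum_components {J : Type*} {X : J → ModuleCat.{u} R} {P : ModuleCat.{u} R}
    (ι : ∀ j, X j ⟶ P) (π : ∀ j, P ⟶ X j)
    (hι : ∀ (Z : ModuleCat.{u} R) (f : P ⟶ Z), (∀ j, ι j ≫ f = 0) → f = 0)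
    (h₁ : ∀ j, ι j ≫ π j = 𝟙 _) (h₂ : ∀ i j, i ≠ j → ι i ≫ π j = 0) (x : P) :
    ∃ s : Finset J, ∀ t : Finset J, s ⊆ t → ∑ j ∈ t, (π j ≫ ι j) x = x := by
  classical
  let M : Submodule R P := ⨆ j, LinearMap.range (ι j).hom
  have hM : M = ⊤ := by
    rw [← Submodule.ker_mkQ M, LinearMap.ker_eq_top]
    have := hι (ModuleCat.of R (P ⧸ M)) (ModuleCat.ofHom M.mkQ) (fun j ↦ by
      ext y
      exact (Submodule.Quotient.mk_eq_zero M).2 (Submodule.mem_iSup_of_mem j ⟨y, rfl⟩))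
    exact congr_arg ModuleCat.Hom.hom this
  have hx : x ∈ M := hM ▸ Submodule.mem_top
  refine Submodule.iSup_induction (motive := fun x ↦ ∃ s : Finset J, ∀ t : Finset J, s ⊆ t →
    ∑ j ∈ t, (π j ≫ ι j) x = x) _ hx ?_ ⟨∅, by simp⟩ ?_
  · rintro i _ ⟨y, rfl⟩
    refine ⟨{i}, fun t ht ↦ ?_⟩
    rw [Finset.sum_eq_single_of_mem i (ht (by simp))]
    · have := congr_arg (fun f ↦ (f ≫ ι i) y) (h₁ i)
      simpa using this
    · intro j _ hj
      have := congr_arg (fun f ↦ (f ≫ ι j) y) (h₂ i j hj.symm)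
      simpa using this
  · rintro x y ⟨s, hs⟩ ⟨s', hs'⟩
    refine ⟨s ∪ s', fun t ht ↦ ?_⟩
    simp only [map_add, Finset.sum_add_distrib]
    rw [hs t (Finset.subset_union_left.trans ht), hs' t (Finset.subset_union_right.trans ht)]

/-- The free module on a type is a coproduct of copies of the ring. -/
lemma nonempty_isColimit_finsupp (N : Type u) : Nonempty (IsColimit
    (Cofan.mk (ModuleCat.of R (N →₀ R)) (fun x : N ↦
      (ModuleCat.ofHom (Finsupp.lsingle x) : ModuleCat.of R R ⟶ _)))) := by
  refine Cofan.IsColimit.nonempty_of_existsUnique (fun Z φ ↦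
    ⟨ModuleCat.ofHom (Finsupp.lsum ℕ fun x ↦ (φ x).hom), fun x ↦ ?_⟩) (fun Z f g H ↦ ?_)
  · ext
    simp
  · ext x
    exact congr($(H x) 1)

end ModuleCat

namespace CochainComplex

variable {C : Type*} [Category C] [Abelian C]

instance isKProjective_single (P : C) [Projective P] (n : ℤ) :
    ((CochainComplex.singleFunctor C n).obj P).IsKProjective := by
  have : ∀ k, Projective (((CochainComplex.singleFunctor C n).obj P).X k) := fun k ↦ by
    by_cases hk : k = n
    · subst hk
      exact Projective.of_iso (HomologicalComplex.singleObjXSelf (ComplexShape.up ℤ) k P).symm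
        inferInstance
    · exact Projective.of_iso (HomologicalComplex.isZero_single_obj_X (ComplexShape.up ℤ) n P k
        hk).isoZero.symm inferInstance
  exact isKProjective_of_projective _ n

lemma nonempty_isColimit_single {J : Type*} {X : J → C} {P : C} {ι : ∀ j, X j ⟶ P}
    (h : IsColimit (Cofan.mk P ι)) (n k : ℤ) : Nonempty (IsColimit
      (Cofan.mk (((HomologicalComplex.single C (ComplexShape.up ℤ) n).obj P).X k)
        (fun j ↦ ((HomologicalComplex.single C (ComplexShape.up ℤ) n).map (ι j)).f k))) := by
  by_cases hk : k = n
  · subst hk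
    have key : ∀ j, ((HomologicalComplex.single C (ComplexShape.up ℤ) k).map (ι j)).f k =
      (HomologicalComplex.singleObjXSelf (ComplexShape.up ℤ) k (X j)).hom ≫ ι j ≫
      (HomologicalComplex.singleObjXSelf (ComplexShape.up ℤ) k P).inv := fun j ↦
        HomologicalComplex.single_map_f_self (c := ComplexShape.up ℤ) k (ι j)
    refine Cofan.IsColimit.nonempty_of_existsUnique (fun Z φ ↦
      ⟨(HomologicalComplex.singleObjXSelf (ComplexShape.up ℤ) k P).hom ≫
      Cofan.IsColimit.mkDesc h (fun j ↦
        (HomologicalComplex.singleObjXSelf (ComplexShape.up ℤ) k (X j)).inv ≫ φ j), fun j ↦ ?_⟩)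
      (fun Z f g H ↦ ?_)
    · rw [key]
      simp [Cofan.IsColimit.ι_mkDesc]
    · rw [← cancel_epi (HomologicalComplex.singleObjXSelf (ComplexShape.up ℤ) k P).inv]
      refine Cofan.IsColimit.mk_hom_ext h fun j ↦ ?_
      have := H j
      rw [key] at this
      simpa using this
  · have h0 := HomologicalComplex.isZero_single_obj_X (ComplexShape.up ℤ) n P k hk
    have h0' := fun j ↦ HomologicalComplex.isZero_single_obj_X (ComplexShape.up ℤ) n (X j) k hk
    exact Cofan.IsColimit.nonempty_of_existsUnique
      (fun Z φ ↦ ⟨0, fun j ↦ (h0' j).eq_of_src _ _⟩) (fun Z f g H ↦ h0.eq_of_src _ _)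

lemma nonempty_isColimit_eval {J : Type*} (K : J → CochainComplex C ℤ)
    [HasColimitsOfShape (Discrete J) C] (k : ℤ) : Nonempty (IsColimit
      (Cofan.mk ((∐ K).X k) (fun j ↦ (Sigma.ι K j).f k))) :=
  ⟨(isColimitMapCoconeCofanMkEquiv (HomologicalComplex.eval C (ComplexShape.up ℤ) k) _ _)
    (isColimitOfPreserves _ (coproductIsCoproduct K))⟩

end CochainComplex

namespace DerivedCategory

variable {C : Type*} [Category C] [Abelian C] [HasDerivedCategory C]

/-- The object of the derived category attached to an object in a single degree is represented by
the corresponding single complex. -/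
noncomputable def singleIsoQ (n : ℤ) (P : C) : (singleFunctor C n).obj P ≅
    Q.obj ((HomologicalComplex.single C (ComplexShape.up ℤ) n).obj P) :=
  Iso.refl _

lemma exists_singleIsoQ_comp_eq {P : C} [Projective P] {n : ℤ} {K : CochainComplex C ℤ}
    (f : (singleFunctor C n).obj P ⟶ Q.obj K) :
    ∃ g : (HomologicalComplex.single C (ComplexShape.up ℤ) n).obj P ⟶ K,
      f = (singleIsoQ n P).hom ≫ Q.map g := by
  have : CochainComplex.IsKProjective ((HomologicalComplex.single C (ComplexShape.up ℤ) n).obj P) :=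
    CochainComplex.isKProjective_single P n
  obtain ⟨g, hg⟩ := Q_map_surjective_of_isKProjective ((singleIsoQ n P).inv ≫ f)
  exact ⟨g, by rw [hg, Iso.hom_inv_id_assoc]⟩

/-- There are no nonzero morphisms from a projective object placed in degree `n` to an object in
degrees `< n`. -/
lemma single_hom_eq_zero_of_projective {P : C} [Projective P] {n : ℤ} {L : DerivedCategory C}
    (m : ℤ) (hm : m < n) [L.IsLE m] (f : (singleFunctor C n).obj P ⟶ L) : f = 0 := by
  obtain ⟨K, hK, ⟨e⟩⟩ := L.exists_iso_Q_obj_of_isLE m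
  rw [← cancel_mono e.hom, zero_comp]
  obtain ⟨g, hg⟩ := exists_singleIsoQ_comp_eq (f ≫ e.hom)
  have : g = 0 := HomologicalComplex.from_single_hom_ext
    ((K.isZero_of_isStrictlyLE m n hm).eq_of_tgt _ _)
  rw [hg, this, Q.map_zero, comp_zero]

lemma isZero_iff (X : DerivedCategory C) :
    IsZero X ↔ ∀ n, IsZero ((homologyFunctor C n).obj X) := by
  refine ⟨fun h n ↦ (homologyFunctor C n).map_isZero h, fun h ↦ ?_⟩
  have : IsIso (0 : X ⟶ X) := by
    rw [isIso_iff]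
    intro n
    rw [Functor.map_zero, isIsoZero_iff_source_target_isZero]
    exact ⟨h n, h n⟩
  rw [IsZero.iff_id_eq_zero, ← IsIso.hom_inv_id (0 : X ⟶ X), zero_comp]

end DerivedCategory

section

open DerivedCategory

variable {R : Type u} [Ring R]

namespace ModuleCat

/-- Morphisms from a shifted copy of the ring to a coproduct of complexes factor through a
finite number of summands. -/
lemma exists_finset_single_hom {J : Type u} (K : J → CochainComplex (ModuleCat.{u} R) ℤ) (n : ℤ)
    (h : (HomologicalComplex.single _ (ComplexShape.up ℤ) n).obj (ModuleCat.of R R) ⟶ ∐ K) :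
    ∃ (s : Finset J) (a : ∀ j, (HomologicalComplex.single _ (ComplexShape.up ℤ) n).obj
      (ModuleCat.of R R) ⟶ K j), h = ∑ j ∈ s, a j ≫ Sigma.ι K j := by
  classical
  let π : ∀ j, ∐ K ⟶ K j := fun j ↦
    Sigma.desc (fun i ↦ if h : i = j then eqToHom (by rw [h]) else 0)
  obtain ⟨hc⟩ := CochainComplex.nonempty_isColimit_eval K n
  let e := HomologicalComplex.singleObjXSelf (ComplexShape.up ℤ) n (ModuleCat.of R R)
  obtain ⟨s, hs⟩ := exists_finset_sum_components (fun j ↦ (Sigma.ι K j).f n)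
    (fun j ↦ (π j).f n) (fun Z f hf ↦ Cofan.IsColimit.mk_hom_ext hc fun j ↦ by rw [hf, comp_zero])
    (fun j ↦ by rw [← HomologicalComplex.comp_f]; simp [π])
    (fun i j hij ↦ by rw [← HomologicalComplex.comp_f]; simp [π, hij])
    ((e.inv ≫ h.f n) (1 : R))
  refine ⟨s, fun j ↦ h ≫ π j, HomologicalComplex.from_single_hom_ext ?_⟩
  rw [← cancel_epi e.inv]
  ext
  have h1 := hs s subset_rfl
  have h2 : (∑ j ∈ s, (h ≫ π j) ≫ Sigma.ι K j).f n =
      h.f n ≫ ∑ j ∈ s, (π j).f n ≫ (Sigma.ι K j).f n := by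
    rw [Preadditive.comp_sum, ← HomologicalComplex.eval_map, Functor.map_sum]
    simp
    rfl
  rw [h2, ← Category.assoc]
  rw [ModuleCat.hom_comp (e.inv ≫ h.f n), ModuleCat.hom_sum]
  simp only [LinearMap.comp_apply, LinearMap.sum_apply]
  exact h1.symm

end ModuleCat

variable [HasDerivedCategory.{w} (ModuleCat.{u} R)]

lemma DerivedCategory.small_support {I : Type w} {Y : I → DerivedCategory (ModuleCat.{u} R)}
    {c : Cofan Y} (hc : IsColimit c) : Small.{u} {i : I // ¬ IsZero (Y i)} := by
  classical
  have h : ∀ j : {i : I // ¬ IsZero (Y i)}, ∃ k,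
      ∃ y : (homologyFunctor (ModuleCat.{u} R) k).obj (Y j), y ≠ 0 := by
    rintro ⟨i, hi⟩
    rw [isZero_iff] at hi
    push Not at hi
    obtain ⟨k, hk⟩ := hi
    rw [ModuleCat.isZero_iff_subsingleton, not_subsingleton_iff_nontrivial] at hk
    exact ⟨k, exists_ne 0⟩
  choose k y hy using h
  let F : {i : I // ¬ IsZero (Y i)} →
      Σ k : ℤ, (homologyFunctor (ModuleCat.{u} R) k).obj c.pt :=
    fun j ↦ ⟨k j, (homologyFunctor _ (k j)).map (c.inj j.1) (y j)⟩
  refine small_of_injective (f := F) fun j j' hjj' ↦ ?_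
  by_contra hne
  let p : c.pt ⟶ Y j.1 := Cofan.IsColimit.desc hc
    (fun i ↦ if h : i = j.1 then eqToHom (by rw [h]) else 0)
  have hp : c.inj j.1 ≫ p = 𝟙 _ := by simp [p, Cofan.IsColimit.fac]
  have hp' : c.inj j'.1 ≫ p = 0 := by
    rw [Cofan.IsColimit.fac, dif_neg]
    intro h
    exact hne (Subtype.ext h.symm)
  let G : (Σ k : ℤ, (homologyFunctor (ModuleCat.{u} R) k).obj c.pt) →
      Σ k : ℤ, (homologyFunctor (ModuleCat.{u} R) k).obj (Y j.1) :=
    fun z ↦ ⟨z.1, (homologyFunctor _ z.1).map p z.2⟩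
  have h1 : G (F j) = ⟨k j, y j⟩ := by
    have := congr_arg (fun f : Y j.1 ⟶ Y j.1 ↦
      (homologyFunctor (ModuleCat.{u} R) (k j)).map f (y j)) hp
    rw [Functor.map_comp, CategoryTheory.Functor.map_id] at this
    exact Sigma.ext rfl (heq_of_eq this)
  have h2 : G (F j') = ⟨k j', 0⟩ := by
    have := congr_arg (fun f : Y j'.1 ⟶ Y j.1 ↦
      (homologyFunctor (ModuleCat.{u} R) (k j')).map f (y j')) hp'
    simp only [Functor.map_comp, Functor.map_zero] at this
    exact Sigma.ext rfl (heq_of_eq this)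
  rw [hjj', h2] at h1
  have h3 : ∀ (a b : ℤ) (z : (homologyFunctor (ModuleCat.{u} R) b).obj (Y j.1)),
      (⟨a, 0⟩ : Σ k : ℤ, (homologyFunctor (ModuleCat.{u} R) k).obj (Y j.1)) = ⟨b, z⟩ → z = 0 := by
    intro a b z hz
    obtain rfl := congr_arg Sigma.fst hz
    exact (eq_of_heq (Sigma.mk.inj hz).2).symm
  exact hy j (h3 _ _ _ h1)

/-- The shifts of the ring are compact in the derived category. -/
lemma isCompactObject_single (n : ℤ) : IsCompactObject.{w}
    ((singleFunctor (ModuleCat.{u} R) n).obj (ModuleCat.of R R)) := by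
  classical
  rw [IsCompactObject.iff_cofanRange]
  intro I Y c hc f
  have := small_support hc
  let σ := equivShrink.{u} {i : I // ¬ IsZero (Y i)}
  let L := Q.objPreimage c.pt
  let e : Q.obj L ≅ c.pt := Q.objObjPreimageIso c.pt
  have key : ∀ i : I, ∃ (K : CochainComplex (ModuleCat.{u} R) ℤ) (a : Q.obj K ≅ Y i)
      (g : K ⟶ L), Q.map g ≫ e.hom = a.hom ≫ c.inj i := by
    intro i
    let b := Q.objObjPreimageIso (Y i)
    obtain ⟨K, s, hs, g, hg⟩ := right_fac (b.hom ≫ c.inj i ≫ e.inv)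
    have := hs
    refine ⟨K, asIso (Q.map s) ≪≫ b, g, ?_⟩
    dsimp only [Iso.trans_hom, asIso_hom]
    rw [← cancel_mono e.inv, Category.assoc, e.hom_inv_id, Category.comp_id, Category.assoc,
      Category.assoc, hg, IsIso.hom_inv_id_assoc]
  choose K a g hg using key
  let K' : Shrink.{u} {i : I // ¬ IsZero (Y i)} → CochainComplex (ModuleCat.{u} R) ℤ :=
    fun j ↦ K (σ.symm j).1
  let ψ : ∐ K' ⟶ L := Sigma.desc (fun j ↦ g (σ.symm j).1)
  have hψ : ∀ j, Q.map (Sigma.ι K' j) ≫ Q.map ψ ≫ e.hom =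
      (a (σ.symm j).1).hom ≫ c.inj (σ.symm j).1 := fun j ↦ by
    rw [← Functor.map_comp_assoc, Sigma.ι_desc, hg]
  have hφ : ∃ φ : c.pt ⟶ Q.obj (∐ K'), φ ≫ Q.map ψ ≫ e.hom = 𝟙 _ := by
    have : ∀ i, ∃ φ : Y i ⟶ Q.obj (∐ K'), φ ≫ Q.map ψ ≫ e.hom = c.inj i := by
      intro i
      by_cases hi : IsZero (Y i)
      · exact ⟨0, hi.eq_of_src _ _⟩
      · obtain ⟨j, hj⟩ : ∃ j, σ.symm j = ⟨i, hi⟩ := ⟨σ ⟨i, hi⟩, by simp⟩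
        have h1 := hψ j
        have h2 : (σ.symm j).1 = i := by rw [hj]
        clear_value σ
        subst h2
        exact ⟨(a (σ.symm j).1).inv ≫ Q.map (Sigma.ι K' j), by
          rw [Category.assoc, h1, Iso.inv_hom_id_assoc]⟩
    choose φ hφ using this
    refine ⟨Cofan.IsColimit.desc hc φ, Cofan.IsColimit.hom_ext hc _ _ fun i ↦ ?_⟩
    rw [← Category.assoc, Cofan.IsColimit.fac, hφ, Category.comp_id]
  obtain ⟨φ, hφ⟩ := hφ
  obtain ⟨h, hh⟩ := exists_singleIsoQ_comp_eq (f ≫ φ)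
  obtain ⟨s, b, hb⟩ := ModuleCat.exists_finset_single_hom K' n h
  have hf : f = (singleIsoQ n _).hom ≫ Q.map h ≫ Q.map ψ ≫ e.hom := by
    rw [← Category.assoc, ← hh, Category.assoc, hφ, Category.comp_id]
  rw [hf, hb, Functor.map_sum, Preadditive.sum_comp]
  refine IsCompactObject.comp_mem_cofanRange c _ (sum_mem fun j _ ↦ ?_)
  rw [Functor.map_comp, Category.assoc, hψ, ← Category.assoc]
  exact IsCompactObject.comp_inj_mem_cofanRange c _ _

end

namespace CochainComplex

variable {C : Type*} [Category C] [Abelian C]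

lemma quasiIso_of_opEquivalence {K L : CochainComplex C ℤ} (g : K ⟶ L)
    [h : QuasiIso ((opEquivalence C).functor.map g.op)] : QuasiIso g := by
  refine ⟨fun n ↦ ?_⟩
  obtain ⟨n, rfl⟩ : ∃ m, n = -m := ⟨-n, by simp⟩
  have h1 := (quasiIsoAt_iff' ((opEquivalence C).functor.map g.op) (n - 1) n (n + 1)
    (by simp) (by simp)).1 inferInstance
  rw [quasiIsoAt_iff' g (-(n + 1)) (-n) (-(n - 1)) (by grind [CochainComplex.prev])
    (by grind [CochainComplex.next]), ← ShortComplex.quasiIso_opMap_iff]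
  exact h1

/-- A bounded above cochain complex has a resolution by projective objects. -/
lemma exists_quasiIso_projective [EnoughProjectives C] (K : CochainComplex C ℤ) (n : ℤ)
    [K.IsStrictlyLE n] : ∃ (P : CochainComplex C ℤ) (p : P ⟶ K) (_ : QuasiIso p)
      (_ : ∀ k, Projective (P.X k)), P.IsStrictlyLE n := by
  let E := opEquivalence C
  let K' := E.functor.obj (Opposite.op K)
  have : K'.IsStrictlyGE (-n) := by
    rw [isStrictlyGE_iff]
    intro i hi
    exact (K.isZero_of_isStrictlyLE n (-i) (by lia)).op
  obtain ⟨L, i, _, _, _⟩ :=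
    CochainComplex.Plus.modelCategoryQuillen.exists_quasiIso_injective K' (-n)
  let P : CochainComplex C ℤ := (E.inverse.obj L).unop
  let e : E.functor.obj (Opposite.op P) ≅ L := E.counitIso.app L
  have hX : ∀ k, L.X k ≅ Opposite.op (P.X (-k)) := fun k ↦
    (HomologicalComplex.eval _ _ k).mapIso e.symm
  obtain ⟨p, hp⟩ := E.functor.map_surjective (i ≫ e.inv)
  have : QuasiIso (E.functor.map p.unop.op) := by
    change QuasiIso (E.functor.map p)
    rw [hp]
    infer_instance
  refine ⟨P, p.unop, quasiIso_of_opEquivalence p.unop, fun k ↦ ?_, ?_⟩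
  · obtain ⟨k, rfl⟩ : ∃ m, k = -m := ⟨-k, by simp⟩
    rw [Injective.projective_iff_injective_op]
    exact Injective.of_iso (hX k) inferInstance
  · rw [isStrictlyLE_iff]
    intro k hk
    obtain ⟨k, rfl⟩ : ∃ m, k = -m := ⟨-k, by simp⟩
    exact ((L.isZero_of_isStrictlyGE (-n) k (by lia)).of_iso (hX k).symm).unop

end CochainComplex

namespace DerivedCategory

variable {C : Type*} [Category C] [Abelian C] [HasDerivedCategory C]

lemma exists_iso_Q_obj_of_projective [EnoughProjectives C] (X : DerivedCategory C) (n : ℤ)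
    [X.IsLE n] : ∃ (P : CochainComplex C ℤ) (_ : P.IsStrictlyLE n) (_ : P.IsKProjective),
      Nonempty (X ≅ Q.obj P) := by
  obtain ⟨K, _, ⟨e⟩⟩ := X.exists_iso_Q_obj_of_isLE n
  obtain ⟨P, p, _, _, _⟩ := CochainComplex.exists_quasiIso_projective K n
  exact ⟨P, inferInstance, CochainComplex.isKProjective_of_projective P n,
    ⟨e ≪≫ (asIso (Q.map p)).symm⟩⟩

end DerivedCategory

namespace DerivedCategory

variable {C : Type*} [Category C] [Abelian C] [HasDerivedCategory C]

/-- The inclusion in degree `n` preserves coproducts of projective objects. -/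
lemma nonempty_isColimit_singleFunctor {J : Type*} {X : J → C} [∀ j, Projective (X j)] {P : C}
    {ι : ∀ j, X j ⟶ P} (h : IsColimit (Cofan.mk P ι)) (n : ℤ) :
    Nonempty (IsColimit (Cofan.mk ((singleFunctor C n).obj P)
      (fun j ↦ (singleFunctor C n).map (ι j)))) := by
  let K : J → CochainComplex C ℤ := fun j ↦
    (HomologicalComplex.single C (ComplexShape.up ℤ) n).obj (X j)
  have : ∀ j, (K j).IsKProjective := fun j ↦ CochainComplex.isKProjective_single (X j) n
  exact nonempty_isColimit_Q_of_coproduct (K := K)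
    (fun j ↦ (HomologicalComplex.single C (ComplexShape.up ℤ) n).map (ι j))
    (fun k ↦ (CochainComplex.nonempty_isColimit_single h n k).some)

end DerivedCategory

section

open DerivedCategory

variable {R : Type u} [Ring R] [HasDerivedCategory.{w} (ModuleCat.{u} R)]

lemma isCompactObject_single_pi (n : ℤ) (J : Type u) [Fintype J] : IsCompactObject.{w}
    ((singleFunctor (ModuleCat.{u} R) n).obj (ModuleCat.of R (J → R))) := by
  classical
  refine IsCompactObject.of_sum Finset.univ (fun _ : J ↦ (singleFunctor (ModuleCat.{u} R) n).obj
    (ModuleCat.of R R)) (fun _ ↦ isCompactObject_single n)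
    (fun j ↦ (singleFunctor _ n).map (ModuleCat.ofHom (LinearMap.proj j)))
    (fun j ↦ (singleFunctor _ n).map (ModuleCat.ofHom (LinearMap.single R (fun _ : J ↦ R) j))) ?_
  simp only [← Functor.map_comp, ← Functor.map_sum]
  rw [← CategoryTheory.Functor.map_id]
  congr 1
  ext x j
  simp [ModuleCat.hom_sum]

lemma nonempty_isColimit_singleFunctor_finsupp (n : ℤ) (N : Type u) : Nonempty (IsColimit
    (Cofan.mk ((singleFunctor (ModuleCat.{u} R) n).obj (ModuleCat.of R (N →₀ R)))
      (fun x : N ↦ (singleFunctor (ModuleCat.{u} R) n).map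
        (ModuleCat.ofHom (Finsupp.lsingle x) : ModuleCat.of R R ⟶ _)))) := by
  obtain ⟨h⟩ := ModuleCat.nonempty_isColimit_finsupp (R := R) N
  exact nonempty_isColimit_singleFunctor h n

lemma small_of_nontrivial [Nontrivial R] (N : Type u) : Small.{w} N := by
  have := small_self ((singleFunctor (ModuleCat.{u} R) 0).obj (ModuleCat.of R R) ⟶
    (singleFunctor (ModuleCat.{u} R) 0).obj (ModuleCat.of R (N →₀ R)))
  refine small_of_injective (f := fun x ↦ (singleFunctor (ModuleCat.{u} R) 0).map
        (ModuleCat.ofHom (Finsupp.lsingle x : R →ₗ[R] N →₀ R))) fun x y h ↦ ?_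
  have h1 := congr($((singleFunctor (ModuleCat.{u} R) 0).map_injective h) (1 : R))
  exact Finsupp.single_left_injective one_ne_zero h1

/-- A morphism from a compact object to a free module in a single degree factors through a
finite free summand. -/
lemma IsCompactObject.exists_finset_finsupp {S : DerivedCategory (ModuleCat.{u} R)}
    (hS : IsCompactObject.{w} S) {n : ℤ} {N : Type u}
    (f : S ⟶ (singleFunctor (ModuleCat.{u} R) n).obj (ModuleCat.of R (N →₀ R))) :
    ∃ (s : Finset N) (i : ModuleCat.of R (s → R) ⟶ ModuleCat.of R (N →₀ R))
      (q : ModuleCat.of R (N →₀ R) ⟶ ModuleCat.of R (s → R)), i ≫ q = 𝟙 _ ∧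
      f ≫ (singleFunctor (ModuleCat.{u} R) n).map (q ≫ i) = f := by
  classical
  obtain ⟨s, a, hs⟩ : ∃ (s : Finset N) (a : ∀ x : N, S ⟶ (singleFunctor (ModuleCat.{u} R) n).obj
      (ModuleCat.of R R)), f = ∑ x ∈ s, a x ≫ (singleFunctor _ n).map
        (ModuleCat.ofHom (Finsupp.lsingle x)) := by
    obtain h | h := subsingleton_or_nontrivial R
    · refine ⟨∅, fun _ ↦ 0, IsZero.eq_of_tgt ?_ _ _⟩
      exact (singleFunctor _ n).map_isZero ((ModuleCat.isZero_iff_subsingleton).2 inferInstance)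
    · have := small_of_nontrivial.{w} (R := R) N
      let σ := equivShrink.{w} N
      obtain ⟨h⟩ := nonempty_isColimit_singleFunctor_finsupp (R := R) n N
      obtain ⟨h'⟩ := Cofan.IsColimit.nonempty_reindex h σ.symm
      obtain ⟨s, a, hs⟩ := hS.exists_finset h' f
      refine ⟨s.map σ.symm.toEmbedding, fun x ↦ a (σ x), hs.trans ?_⟩
      rw [Finset.sum_map]
      refine Finset.sum_congr rfl fun x _ ↦ ?_
      simp only [Equiv.coe_toEmbedding, Equiv.apply_symm_apply]
      rfl
  let i : ModuleCat.of R (s → R) ⟶ ModuleCat.of R (N →₀ R) :=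
    ModuleCat.ofHom (∑ x : s, Finsupp.lsingle x.1 ∘ₗ LinearMap.proj x)
  let q : ModuleCat.of R (N →₀ R) ⟶ ModuleCat.of R (s → R) :=
    ModuleCat.ofHom (LinearMap.pi fun x : s ↦ Finsupp.lapply x.1)
  have hq : ∀ x ∈ s, ModuleCat.ofHom (Finsupp.lsingle x) ≫ q ≫ i =
      (ModuleCat.ofHom (Finsupp.lsingle x) : ModuleCat.of R R ⟶ _) := fun x hx ↦ by
    refine ModuleCat.hom_ext (LinearMap.ext_ring ?_)
    simp [q, i]
    rw [Finset.sum_eq_single_of_mem x hx, Finsupp.single_eq_same]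
    intro y _ hy
    rw [Finsupp.single_eq_of_ne hy, Finsupp.single_zero]
  refine ⟨s, i, q, ?_, ?_⟩
  · ext x j
    simp [i, q]
    rw [Finset.sum_eq_single_of_mem j (Finset.mem_attach _ _), Finsupp.single_eq_same]
    intro y _ hy
    rw [Finsupp.single_eq_of_ne (fun h ↦ hy (Subtype.ext h).symm)]
  · rw [hs, Preadditive.sum_comp]
    refine Finset.sum_congr rfl fun x hx ↦ ?_
    rw [Category.assoc, ← Functor.map_comp, hq x hx]

end

namespace CochainComplex

variable {C : Type*} [Category C] [Abelian C] {L : CochainComplex C ℤ}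
  {K : ℕ → CochainComplex C ℤ} {P : CochainComplex C ℤ}

/-- The morphism to a coproduct of complexes with given components, when the `n`-th summand
is concentrated in degrees `≤ -n`. -/
def toCoproduct (ι : ∀ n, K n ⟶ P) (hK : ∀ n, (K n).IsStrictlyLE (-n)) (g : ∀ n, L ⟶ K n) :
    L ⟶ P where
  f k := ∑ n ∈ Finset.range ((-k).toNat + 1), (g n).f k ≫ (ι n).f k
  comm' k l hkl := by
    obtain rfl : k + 1 = l := hkl
    rw [Preadditive.sum_comp, Preadditive.comp_sum]
    symm
    refine Finset.sum_subset_zero_on_sdiff (Finset.range_mono (by lia)) (fun n hn ↦ ?_)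
      (fun n _ ↦ by simp)
    rw [Finset.mem_sdiff, Finset.mem_range, Finset.mem_range] at hn
    rw [Category.assoc, HomologicalComplex.Hom.comm,
      ((K n).isZero_of_isStrictlyLE (-n) (k + 1) (by lia)).eq_of_tgt ((K n).d k (k + 1)) 0,
      zero_comp, comp_zero]

lemma toCoproduct_comp (ι : ∀ n, K n ⟶ P) (hK : ∀ n, (K n).IsStrictlyLE (-n)) (g : ∀ n, L ⟶ K n)
    (m : ℕ) (π : P ⟶ K m) (h₁ : ι m ≫ π = 𝟙 _) (h₂ : ∀ n, n ≠ m → ι n ≫ π = 0) :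
    toCoproduct ι hK g ≫ π = g m := by
  ext k
  rw [HomologicalComplex.comp_f]
  change (∑ n ∈ Finset.range ((-k).toNat + 1), (g n).f k ≫ (ι n).f k) ≫ π.f k = _
  rw [Preadditive.sum_comp]
  simp only [Category.assoc, ← HomologicalComplex.comp_f]
  by_cases hm : m < (-k).toNat + 1
  · rw [Finset.sum_eq_single_of_mem m (Finset.mem_range.2 hm), h₁, Category.comp_id]
    intro n _ hn
    rw [h₂ n hn, comp_zero, HomologicalComplex.zero_f]
  · exact ((K m).isZero_of_isStrictlyLE (-m) k (by lia)).eq_of_tgt _ _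

end CochainComplex

namespace IsCompactObject

open DerivedCategory

variable {C : Type*} [Category C] [Abelian C] [EnoughProjectives C]
  [HasColimitsOfShape (Discrete ℕ) C] [HasDerivedCategory C]

/-- A family of morphisms from a bounded above compact object to objects in lower and lower
degrees contains a zero morphism. -/
lemma exists_eq_zero_of_isLE {S : DerivedCategory C} (hS : IsCompactObject.{w} S)
    (m : ℤ) [S.IsLE m] (X : ℕ → DerivedCategory C) (hX : ∀ n : ℕ, (X n).IsLE (-n))
    (f : ∀ n, S ⟶ X n) : ∃ n, f n = 0 := by
  classical
  obtain ⟨L, _, _, ⟨e⟩⟩ := S.exists_iso_Q_obj_of_projective m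
  choose K hK hK' e' using fun n ↦ (X n).exists_iso_Q_obj_of_projective (-n)
  replace e' := fun n ↦ (e' n).some
  choose g hg using fun n ↦ Q_map_surjective_of_isKProjective (e.inv ≫ f n ≫ (e' n).hom)
  obtain ⟨h⟩ := nonempty_isColimit_Q_of_coproduct (Sigma.ι K)
    (fun k ↦ (CochainComplex.nonempty_isColimit_eval K k).some)
  let σ : ULift.{w} ℕ ≃ ℕ := Equiv.ulift
  obtain ⟨h'⟩ := Cofan.IsColimit.nonempty_reindex h σ
  obtain ⟨s, a, hs⟩ := hS.exists_finset h'
    (e.hom ≫ Q.map (CochainComplex.toCoproduct (Sigma.ι K) hK g))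
  obtain ⟨N, hN⟩ := Infinite.exists_notMem_finset s
  let π : ∐ K ⟶ K (σ N) := Sigma.desc (fun i ↦ if h : i = σ N then eqToHom (by rw [h]) else 0)
  have hπ : ∀ n, n ≠ σ N → Sigma.ι K n ≫ π = 0 := fun n hn ↦ by simp [π, hn]
  have h0 : Q.map (g (σ N)) = 0 := by
    rw [← CochainComplex.toCoproduct_comp (Sigma.ι K) hK g (σ N) π (by simp [π]) hπ,
      Functor.map_comp, ← cancel_epi e.hom, ← Category.assoc, hs, Preadditive.sum_comp, comp_zero]
    refine Finset.sum_eq_zero fun n hn ↦ ?_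
    have : σ n ≠ σ N := fun h ↦ hN (by rwa [← σ.injective h])
    change (a n ≫ Q.map (Sigma.ι K (σ n))) ≫ _ = 0
    rw [Category.assoc, ← Functor.map_comp, hπ _ this, Functor.map_zero, comp_zero]
  refine ⟨σ N, ?_⟩
  rw [hg] at h0
  simpa using congr(e.hom ≫ $h0 ≫ (e' (σ N)).inv)

end IsCompactObject

namespace DerivedCategory

open Pretriangulated

section

variable {C : Type*} [Category C] [Abelian C] [HasDerivedCategory C] {X Y Z : DerivedCategory C}
  {f : X ⟶ Y} {g : Y ⟶ Z} {h : Z ⟶ X⟦(1 : ℤ)⟧}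

lemma exact_homologyFunctor₂ (hT : Triangle.mk f g h ∈ distTriang _) (n : ℤ) :
    ∃ w, (ShortComplex.mk ((homologyFunctor C n).map f) ((homologyFunctor C n).map g) w).Exact :=
  ⟨_, HomologySequence.exact₂ _ hT n⟩

lemma exact_homologyFunctor₃ (hT : Triangle.mk f g h ∈ distTriang _) (n₀ n₁ : ℤ)
    (hn : n₀ + 1 = n₁) :
    ∃ (δ : (homologyFunctor C n₀).obj Z ⟶ (homologyFunctor C n₁).obj X) (w : _),
      (ShortComplex.mk ((homologyFunctor C n₀).map g) δ w).Exact :=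
  ⟨_, _, HomologySequence.exact₃ _ hT n₀ n₁ hn⟩

lemma exact_homologyFunctor₁ (hT : Triangle.mk f g h ∈ distTriang _) (n₀ n₁ : ℤ)
    (hn : n₀ + 1 = n₁) :
    ∃ (δ : (homologyFunctor C n₀).obj Z ⟶ (homologyFunctor C n₁).obj X) (w : _),
      (ShortComplex.mk δ ((homologyFunctor C n₁).map f) w).Exact :=
  ⟨_, _, HomologySequence.exact₁ _ hT n₀ n₁ hn⟩

lemma isLE₂_of_distTriang (hT : Triangle.mk f g h ∈ distTriang _) (n : ℤ) [X.IsLE n] [Z.IsLE n] :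
    Y.IsLE n := by
  rw [isLE_iff]
  intro k hk
  obtain ⟨_, hex⟩ := exact_homologyFunctor₂ hT k
  exact hex.isZero_X₂ ((X.isZero_of_isLE n k hk).eq_of_src _ _)
    ((Z.isZero_of_isLE n k hk).eq_of_tgt _ _)

lemma isLE₃_of_distTriang (hT : Triangle.mk f g h ∈ distTriang _) (n m : ℤ) (hm : m + 1 = n)
    [X.IsLE n] [Y.IsLE n] [Epi ((homologyFunctor C n).map f)] :
    Z.IsLE m := by
  rw [isLE_iff]
  intro k hk
  obtain ⟨_, _, hex⟩ := exact_homologyFunctor₃ hT k (k + 1) rfl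
  refine hex.isZero_X₂ ?_ ((X.isZero_of_isLE n (k + 1) (by lia)).eq_of_tgt _ _)
  obtain rfl | hk' := eq_or_ne k n
  · obtain ⟨w, _⟩ := exact_homologyFunctor₂ hT k
    exact zero_of_epi_comp _ w
  · exact (Y.isZero_of_isLE n k (by lia)).eq_of_src _ _

end

section

variable {R : Type u} [Ring R] [HasDerivedCategory.{w} (ModuleCat.{u} R)]

/-- The top cohomology of an object is killed by attaching a free module in a single degree. -/
lemma exists_triangle_from_finsupp (X : DerivedCategory (ModuleCat.{u} R)) (n m : ℤ)
    (hm : m + 1 = n) [X.IsLE n] : ∃ (N : Type u) (X' : DerivedCategory (ModuleCat.{u} R))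
      (_ : X'.IsLE m) (a : (singleFunctor _ n).obj (ModuleCat.of R (N →₀ R)) ⟶ X) (p : X ⟶ X')
      (d : X' ⟶ ((singleFunctor _ n).obj (ModuleCat.of R (N →₀ R)))⟦(1 : ℤ)⟧),
      Triangle.mk a p d ∈ distTriang _ := by
  obtain ⟨A, _, M, a', p', d', hT, _⟩ := exists_triangle_to_single X n m hm
  let φ : ModuleCat.of R (M →₀ R) ⟶ M := ModuleCat.ofHom (Finsupp.linearCombination R id)
  have : Epi φ := (ModuleCat.epi_iff_surjective _).2 (Finsupp.linearCombination_id_surjective R M)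
  have : Projective (ModuleCat.of R (M →₀ R)) := inferInstance
  have : (A⟦(1 : ℤ)⟧).IsLE (m - 1) := TStructure.t.isLE_shift A m 1 (m - 1) (by lia)
  obtain ⟨a, ha⟩ := exists_comp_mor₂_eq hT ((singleFunctor _ n).map φ)
    (single_hom_eq_zero_of_projective (m - 1) (by lia) _)
  obtain ⟨X', p, d, hT'⟩ := distinguished_cocone_triangle a
  have h1 : Epi ((homologyFunctor _ n).map ((singleFunctor (ModuleCat.{u} R) n).map φ)) := by
    have : Epi (((singleFunctor (ModuleCat.{u} R) n) ⋙ homologyFunctor _ n).map φ) := by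
      rw [← NatIso.naturality_2 (singleFunctorCompHomologyFunctorIso (ModuleCat.{u} R) n) φ]
      dsimp only [Functor.id_map, Functor.id_obj]
      infer_instance
    exact this
  have : Epi ((homologyFunctor _ n).map a) := by
    rw [ha, Functor.map_comp] at h1
    rw [← Category.comp_id ((homologyFunctor _ n).map a),
      ← IsIso.hom_inv_id ((homologyFunctor _ n).map p'), ← Category.assoc]
    exact epi_comp _ _
  exact ⟨M, X', isLE₃_of_distTriang hT' n m hm, a, p, d, hT'⟩

end

end DerivedCategory

namespace CategoryTheory.Pretriangulated

variable {D : Type*} [Category D] [Preadditive D] [HasZeroObject D] [HasShift D ℤ]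
  [∀ n : ℤ, (shiftFunctor D n).Additive] [Pretriangulated D]

/-- A factorization of `f ≫ p` through `B'` lifts to a factorization of `f` through an extension
of `B'`, up to a morphism that factors through the first object of the triangle. -/
lemma exists_factorization_of_distTriang {F X X' : D} {a : F ⟶ X} {p : X ⟶ X'} {d : X' ⟶ F⟦(1 : ℤ)⟧}
    (hT : Triangle.mk a p d ∈ distTriang D) {S B' : D} {f : S ⟶ X} {b : S ⟶ B'} {c : B' ⟶ X'}
    (h : f ≫ p = b ≫ c) {G : D} (i : G ⟶ F) (q : F ⟶ G)
    (hq : (c ≫ d) ≫ (q ≫ i)⟦(1 : ℤ)⟧' = c ≫ d) :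
    ∃ (B : D) (j : G ⟶ B) (v : B ⟶ B') (δ : B' ⟶ G⟦(1 : ℤ)⟧) (_ : Triangle.mk j v δ ∈ distTriang D)
      (β : S ⟶ B) (c₀ : B ⟶ X) (γ : S ⟶ F), f = β ≫ c₀ + γ ≫ a := by
  obtain ⟨B, j, v, hT'⟩ := distinguished_cocone_triangle₂ (c ≫ d ≫ q⟦(1 : ℤ)⟧')
  obtain ⟨c₀, h₂⟩ : ∃ c₀ : B ⟶ X, v ≫ c = c₀ ≫ p := by
    have comm : (c ≫ d ≫ q⟦(1 : ℤ)⟧') ≫ i⟦(1 : ℤ)⟧' = c ≫ d := by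
      simpa only [Functor.map_comp, Category.assoc] using hq
    obtain ⟨c₀, -, h₂⟩ := complete_distinguished_triangle_morphism₂ _ _ hT' hT i c comm
    exact ⟨c₀, h₂⟩
  have w : p ≫ d = 0 := comp_distTriang_mor_zero₂₃ _ hT
  obtain ⟨β, hβ⟩ := exists_comp_mor₂_eq hT' b (by
    rw [← reassoc_of% h, reassoc_of% w, zero_comp, comp_zero])
  obtain ⟨γ, hγ⟩ := exists_comp_mor₁_eq hT (f - β ≫ c₀) (by
    rw [Preadditive.sub_comp, h, Category.assoc, ← h₂, hβ, Category.assoc, sub_self])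
  exact ⟨B, j, v, _, hT', β, c₀, γ, by rw [← hγ, add_sub_cancel]⟩

end CategoryTheory.Pretriangulated

lemma ModuleCat.finitePresentation_of_iso {R : Type u} [Ring R] {M N : ModuleCat.{u} R} (e : M ≅ N)
    [Module.FinitePresentation R M] : Module.FinitePresentation R N :=
  Module.FinitePresentation.of_equiv e.toLinearEquiv

namespace DerivedCategory

open Pretriangulated

variable {R : Type u} [Ring R] [HasDerivedCategory.{w} (ModuleCat.{u} R)]

/-- A free module placed in degree `n` and shifted is a free module placed in degree `m`: a
morphism from a compact object only sees finitely many basis elements. -/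
lemma exists_finset_finsupp_shift {S : DerivedCategory (ModuleCat.{u} R)}
    (hS : IsCompactObject.{w} S) {n : ℤ} {N : Type u}
    (f : S ⟶ ((singleFunctor (ModuleCat.{u} R) n).obj (ModuleCat.of R (N →₀ R)))⟦(1 : ℤ)⟧) :
    ∃ (s : Finset N) (i : ModuleCat.of R (s → R) ⟶ ModuleCat.of R (N →₀ R))
      (q : ModuleCat.of R (N →₀ R) ⟶ ModuleCat.of R (s → R)),
      f ≫ ((singleFunctor (ModuleCat.{u} R) n).map (q ≫ i))⟦(1 : ℤ)⟧' = f := by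
  let e := (singleFunctors (ModuleCat.{u} R)).shiftIso 1 (n - 1) n (by lia)
  obtain ⟨s, i, q, -, h⟩ := hS.exists_finset_finsupp (f ≫ e.hom.app _)
  refine ⟨s, i, q, ?_⟩
  have := e.hom.naturality (q ≫ i)
  rw [← cancel_mono (e.hom.app _)]
  refine Eq.trans ?_ h
  rw [Category.assoc, Category.assoc]
  exact congr_arg _ this

/-- The morphisms that factor through a compact object concentrated in degrees `≤ m` whose
cohomology in degree `m` is finitely presented. -/
def FactorsThroughFinitePresentation (m : ℤ) {X Y : DerivedCategory (ModuleCat.{u} R)}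
    (f : X ⟶ Y) : Prop :=
  ∃ B : DerivedCategory (ModuleCat.{u} R), IsCompactObject.{w} B ∧ B.IsLE m ∧
    Module.FinitePresentation R ((homologyFunctor (ModuleCat.{u} R) m).obj B) ∧
    ∃ (b : X ⟶ B) (c : B ⟶ Y), f = b ≫ c

lemma finitePresentation_homologyFunctor_single (n : ℤ) (M : ModuleCat.{u} R)
    [Module.FinitePresentation R M] :
    Module.FinitePresentation R
      ((homologyFunctor (ModuleCat.{u} R) n).obj ((singleFunctor _ n).obj M)) :=
  ModuleCat.finitePresentation_of_iso (M := M)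
    ((singleFunctorCompHomologyFunctorIso _ n).symm.app M)

lemma finitePresentation_homologyFunctor_biprod (n : ℤ) (A B : DerivedCategory (ModuleCat.{u} R))
    [Module.FinitePresentation R ((homologyFunctor (ModuleCat.{u} R) n).obj A)]
    [Module.FinitePresentation R ((homologyFunctor (ModuleCat.{u} R) n).obj B)] :
    Module.FinitePresentation R ((homologyFunctor (ModuleCat.{u} R) n).obj (A ⊞ B)) := by
  have := preservesBinaryBiproducts_of_preservesBiproducts (homologyFunctor (ModuleCat.{u} R) n)
  exact ModuleCat.finitePresentation_of_iso (M := ModuleCat.of R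
    ((homologyFunctor (ModuleCat.{u} R) n).obj A × (homologyFunctor (ModuleCat.{u} R) n).obj B))
    ((ModuleCat.biprodIsoProd _ _).symm ≪≫
      ((homologyFunctor (ModuleCat.{u} R) n).mapBiprod A B).symm)

lemma finitePresentation_homologyFunctor_of_distTriang {A B Z : DerivedCategory (ModuleCat.{u} R)}
    {f : A ⟶ B} {g : B ⟶ Z} {h : Z ⟶ A⟦(1 : ℤ)⟧} (hT : Triangle.mk f g h ∈ distTriang _)
    {n m : ℤ} (hm : m + 1 = n) [Z.IsLE m]
    [Module.Finite R ((homologyFunctor (ModuleCat.{u} R) m).obj Z)]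
    [Module.FinitePresentation R ((homologyFunctor (ModuleCat.{u} R) n).obj A)] :
    Module.FinitePresentation R ((homologyFunctor (ModuleCat.{u} R) n).obj B) := by
  obtain ⟨δ, w₁, h₁⟩ := exact_homologyFunctor₁ hT m n hm
  obtain ⟨w₂, h₂⟩ := exact_homologyFunctor₂ hT n
  have : Epi ((homologyFunctor (ModuleCat.{u} R) n).map f) :=
    h₂.epi_f ((Z.isZero_of_isLE m n (by lia)).eq_of_tgt _ _)
  refine Module.finitePresentation_of_surjective ((homologyFunctor (ModuleCat.{u} R) n).map f).hom
    ((ModuleCat.epi_iff_surjective _).1 this) ?_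
  rw [ShortComplex.moduleCat_exact_iff_range_eq_ker] at h₁
  change LinearMap.range δ.hom = _ at h₁
  rw [← h₁, LinearMap.range_eq_map]
  exact (Module.Finite.fg_top).map _

lemma factorsThroughFinitePresentation_of_distTriang {S X X' : DerivedCategory (ModuleCat.{u} R)}
    (hS : IsCompactObject.{w} S) {n m : ℤ} (hm : m + 1 = n) {N : Type u}
    {a : (singleFunctor _ n).obj (ModuleCat.of R (N →₀ R)) ⟶ X} {p : X ⟶ X'}
    {d : X' ⟶ ((singleFunctor _ n).obj (ModuleCat.of R (N →₀ R)))⟦(1 : ℤ)⟧}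
    (hT : Triangle.mk a p d ∈ distTriang _) {f : S ⟶ X}
    (hf : FactorsThroughFinitePresentation m (f ≫ p)) :
    FactorsThroughFinitePresentation n f := by
  obtain ⟨B', hB', _, _, b, c, h⟩ := hf
  obtain ⟨s, i, q, hq⟩ := exists_finset_finsupp_shift hB' (c ≫ d)
  rw [Functor.map_comp] at hq
  obtain ⟨B, j, v, δ, hT', β, c₀, γ, rfl⟩ := exists_factorization_of_distTriang hT h _ _ hq
  obtain ⟨s', i', q', -, hγ⟩ := hS.exists_finset_finsupp γ
  have : B'.IsLE n := TStructure.t.isLE_of_le B' m n (by lia)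
  have : B.IsLE n := isLE₂_of_distTriang hT' n
  have := finitePresentation_homologyFunctor_single n (ModuleCat.of R (s → R))
  have := finitePresentation_homologyFunctor_single n (ModuleCat.of R (s' → R))
  have := finitePresentation_homologyFunctor_of_distTriang hT' hm
  refine ⟨B ⊞ (singleFunctor _ n).obj (ModuleCat.of R (s' → R)),
    (IsCompactObject.of_distTriang _ hT' (isCompactObject_single_pi n s) hB').biprod
      (isCompactObject_single_pi n s'),
    isLE₂_of_distTriang (binaryBiproductTriangle_distinguished _ _) n,
    finitePresentation_homologyFunctor_biprod _ _ _,
    biprod.lift β (γ ≫ (singleFunctor _ n).map q'), biprod.desc c₀ ((singleFunctor _ n).map i' ≫ a),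
    ?_⟩
  rw [biprod.lift_desc, Category.assoc, ← Functor.map_comp_assoc, reassoc_of% hγ]

end DerivedCategory

namespace DerivedCategory

open Pretriangulated

variable {R : Type u} [Ring R] [HasDerivedCategory.{w} (ModuleCat.{u} R)]

lemma _root_.IsCompactObject.isCompactObject_zero {D : Type*} [Category D] [Preadditive D] {S Z : D}
    (hS : IsCompactObject.{w} S) (hZ : IsZero Z) : IsCompactObject.{w} Z :=
  hS.of_retract 0 0 (hZ.eq_of_src _ _)

lemma exists_factorsThroughFinitePresentation_imp {S X : DerivedCategory (ModuleCat.{u} R)}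
    (hS : IsCompactObject.{w} S) (f : S ⟶ X) (n m : ℤ) (hm : m + 1 = n) [X.IsLE n] :
    ∃ (X' : DerivedCategory (ModuleCat.{u} R)) (_ : X'.IsLE m) (f' : S ⟶ X'),
      FactorsThroughFinitePresentation m f' → FactorsThroughFinitePresentation n f := by
  obtain ⟨N, X', hX', a, p, d, hT⟩ := exists_triangle_from_finsupp X n m hm
  exact ⟨X', hX', f ≫ p, factorsThroughFinitePresentation_of_distTriang hS hm hT⟩

/-- Morphisms from a compact object to an object, both in degrees `≤ 0`, factor through a
compact object in degrees `≤ 0` with finitely presented top cohomology. -/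
theorem _root_.IsCompactObject.factorsThroughFinitePresentation
    {S : DerivedCategory (ModuleCat.{u} R)} (hS : IsCompactObject.{w} S) [S.IsLE 0] {X : DerivedCategory (ModuleCat.{u} R)} [X.IsLE 0]
    (f : S ⟶ X) : FactorsThroughFinitePresentation 0 f := by
  let A (n : ℕ) := {t : Σ X : DerivedCategory (ModuleCat.{u} R), (S ⟶ X) // t.1.IsLE (-n)}
  have step (n : ℕ) (t : A n) : ∃ t' : A (n + 1),
      FactorsThroughFinitePresentation (-(n + 1 : ℕ)) t'.1.2 →
        FactorsThroughFinitePresentation (-n) t.1.2 := by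
    have := t.2
    obtain ⟨X', hX', f', h⟩ := exists_factorsThroughFinitePresentation_imp hS t.1.2 (-n)
      (-(n + 1 : ℕ)) (by push_cast; lia)
    exact ⟨⟨⟨X', f'⟩, hX'⟩, h⟩
  choose next hnext using step
  let t₀ : A 0 := ⟨⟨X, f⟩, by simpa⟩
  let t (n : ℕ) : A n := Nat.rec t₀ next n
  have ht (n : ℕ) (h : FactorsThroughFinitePresentation (-n) (t n).1.2) :
      FactorsThroughFinitePresentation 0 f := by
    induction n with
    | zero => exact h
    | succ n ih => exact ih (hnext n (t n) h)
  obtain ⟨n, hn⟩ := hS.exists_eq_zero_of_isLE 0 (fun n ↦ (t n).1.1) (fun n ↦ (t n).2)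
    (fun n ↦ (t n).1.2)
  refine ht n ⟨_, hS.isCompactObject_zero (isZero_zero _), ?_, ?_, 0, 0, by simpa using hn⟩
  · exact (isLE_iff _ _).2 fun k _ ↦ (homologyFunctor _ k).map_isZero (isZero_zero _)
  · have := ModuleCat.isZero_iff_subsingleton.1
      ((homologyFunctor (ModuleCat.{u} R) (-n : ℤ)).map_isZero (isZero_zero _))
    infer_instance

/-- The top cohomology of a compact object is finitely presented. -/
theorem _root_.IsCompactObject.finitePresentation_homologyFunctor
    {S : DerivedCategory (ModuleCat.{u} R)} (hS : IsCompactObject.{w} S) [S.IsLE 0] :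
    Module.FinitePresentation R ((homologyFunctor (ModuleCat.{u} R) 0).obj S) := by
  obtain ⟨B, -, -, _, b, c, h⟩ := hS.factorsThroughFinitePresentation (𝟙 S)
  have h' : ((homologyFunctor (ModuleCat.{u} R) 0).map c).hom ∘ₗ
      ((homologyFunctor (ModuleCat.{u} R) 0).map b).hom = .id := by
    rw [← ModuleCat.hom_comp, ← Functor.map_comp, ← h, CategoryTheory.Functor.map_id,
      ModuleCat.hom_id]
  refine Module.finitePresentation_of_surjective
    ((homologyFunctor (ModuleCat.{u} R) 0).map c).hom ?_ ?_
  · exact Function.LeftInverse.surjective fun x ↦ LinearMap.congr_fun h' x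
  · rw [LinearMap.ker_eq_range_of_comp_eq_id h']
    exact .of_finite

end DerivedCategory

open DerivedCategory

section

variable {R : Type u} [Ring R] {T F : ModuleCat.{u} R → Prop}

lemma ModTorsionPair.torsion_of_isZero (htp : ModTorsionPair R T F) {M : ModuleCat.{u} R}
    (hM : IsZero M) :
    T M := by
  obtain ⟨t, ht, -⟩ := htp.exists_torsion_submodule M
  have := ModuleCat.isZero_iff_subsingleton.1 hM
  exact htp.iso_closed_torsion
    (IsZero.iso (ModuleCat.isZero_iff_subsingleton.2 (inferInstanceAs (Subsingleton t))) hM) ht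

/-- The finitely presented quotients of finite free modules that satisfy `T`. -/
def FinitelyPresentedTorsionQuotients (T : ModuleCat.{u} R → Prop) : Type u :=
  {p : Σ n : ℕ, Submodule R (Fin n → R) // Module.FinitePresentation R ((Fin p.1 → R) ⧸ p.2) ∧
    T (ModuleCat.of R ((Fin p.1 → R) ⧸ p.2))}

lemma ModTorsionPair.exists_finitelyPresentedTorsionQuotients (htp : ModTorsionPair R T F)
    (M : ModuleCat.{u} R) [Module.FinitePresentation R M] (hM : T M) :
    ∃ l : FinitelyPresentedTorsionQuotients T, Nonempty (M ≃ₗ[R] (Fin l.1.1 → R) ⧸ l.1.2) := by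
  obtain ⟨n, K, e, -⟩ := Module.FinitePresentation.exists_fin R M
  exact ⟨⟨⟨n, K⟩, .of_equiv e, htp.iso_closed_torsion e.toModuleIso hM⟩, ⟨e⟩⟩

end

section

variable {R : Type u} [Ring R] [HasDerivedCategory.{w} (ModuleCat.{u} R)]
  {T F : ModuleCat.{u} R → Prop}

lemma DerivedCategory.shift_hom_eq_zero {C : Type*} [Category C] [Abelian C] [HasDerivedCategory C]
    {X Y : DerivedCategory C} [X.IsLE 0] [Y.IsGE 0] {n : ℤ} (hn : 0 < n) (f : X⟦n⟧ ⟶ Y) :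
    f = 0 := by
  have : (X⟦n⟧).IsLE (-n) := TStructure.t.isLE_shift X 0 n (-n) (by lia)
  exact TStructure.t.zero f (-n) 0 (by lia)

lemma DerivedCategory.hom_single_eq_zero {C : Type*} [Category C] [Abelian C] [HasDerivedCategory C]
    {X : DerivedCategory C} {n : ℤ} [X.IsLE n] {M : C}
    (h : ∀ g : (homologyFunctor C n).obj X ⟶ M, g = 0) (f : X ⟶ (singleFunctor C n).obj M) :
    f = 0 := by
  refine hom_eq_zero_of_homologyFunctor_map_eq_zero n _ ?_
  rw [← cancel_mono ((singleFunctorCompHomologyFunctorIso C n).hom.app M), zero_comp]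
  exact h _

lemma isLE_of_mem_hrsAisle {X : DerivedCategory (ModuleCat.{u} R)} (hX : X ∈ HRSAisle R T) :
    X.IsLE 0 :=
  (isLE_iff _ _).2 hX.1

lemma mem_hrsAisle {X : DerivedCategory (ModuleCat.{u} R)} [X.IsLE 0]
    (hX : T ((homologyFunctor (ModuleCat.{u} R) 0).obj X)) : X ∈ HRSAisle R T :=
  ⟨fun k hk ↦ X.isZero_of_isLE 0 k hk, hX⟩

namespace ModTorsionPair

lemma shift_mem_hrsAisle (htp : ModTorsionPair R T F) {X : DerivedCategory (ModuleCat.{u} R)}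
    (hX : X ∈ HRSAisle R T) {n : ℤ} (hn : 0 ≤ n) : X⟦n⟧ ∈ HRSAisle R T := by
  have := isLE_of_mem_hrsAisle hX
  have : (X⟦n⟧).IsLE (-n) := TStructure.t.isLE_shift X 0 n (-n) (by lia)
  have : (X⟦n⟧).IsLE 0 := TStructure.t.isLE_of_le _ (-n) 0 (by lia)
  refine mem_hrsAisle ?_
  obtain rfl | hn := hn.eq_or_lt
  · exact htp.iso_closed_torsion
      ((homologyFunctor _ 0).mapIso ((shiftFunctorZero _ ℤ).symm.app X)) hX.2
  · exact htp.torsion_of_isZero ((X⟦n⟧).isZero_of_isLE (-n) 0 (by lia))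

lemma single_mem_hrsAisle (htp : ModTorsionPair R T F) {M : ModuleCat.{u} R} (hM : T M) :
    (singleFunctor _ 0).obj M ∈ HRSAisle R T :=
  mem_hrsAisle (htp.iso_closed_torsion
    ((singleFunctorCompHomologyFunctorIso (ModuleCat.{u} R) 0).symm.app M) hM)

lemma mem_rightPerp_hrsAisle (htp : ModTorsionPair R T F) {Y : DerivedCategory (ModuleCat.{u} R)}
    [Y.IsGE 0] (hY : F ((homologyFunctor (ModuleCat.{u} R) 0).obj Y)) :
    Y ∈ rightPerp R (HRSAisle R T) := fun X hX f ↦ by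
  have := isLE_of_mem_hrsAisle hX
  refine hom_eq_zero_of_homologyFunctor_map_eq_zero 0 f (ModuleCat.hom_ext ?_)
  exact htp.hom_eq_zero hX.2 hY _

lemma torsionfree_of_single_mem_rightPerp (htp : ModTorsionPair R T F) {M : ModuleCat.{u} R}
    (hM : (singleFunctor _ 0).obj M ∈ rightPerp R (HRSAisle R T)) : F M := by
  obtain ⟨t, ht, ht'⟩ := htp.exists_torsion_submodule M
  have h := hM _ (htp.single_mem_hrsAisle ht)
    ((singleFunctor _ 0).map (ModuleCat.ofHom (Y := M) t.subtype))
  have h0 : ModuleCat.ofHom (Y := M) t.subtype = 0 :=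
    (singleFunctor _ 0).map_injective (h.trans ((singleFunctor _ 0).map_zero _ _).symm)
  have hbot : t = ⊥ := by
    rw [← t.range_subtype, show t.subtype = 0 from congr_arg ModuleCat.Hom.hom h0,
      LinearMap.range_zero]
  exact htp.iso_closed_torsionfree (t.quotEquivOfEqBot hbot).toModuleIso ht'

end ModTorsionPair

theorem ModTorsionPair.exists_finitePresentation_of_hrsCompactlyGenerated
    (htp : ModTorsionPair R T F) (h : HRSCompactlyGenerated R T) :
    ∃ (Λ : Type u) (Tfam : Λ → ModuleCat.{u} R),
      (∀ l, Module.FinitePresentation R (Tfam l)) ∧ (∀ l, T (Tfam l)) ∧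
      ∀ M : ModuleCat.{u} R, F M ↔ ∀ (l : Λ) (f : Tfam l →ₗ[R] M), f = 0 := by
  obtain ⟨S, hS, hSU, h⟩ := h
  refine ⟨FinitelyPresentedTorsionQuotients T,
    fun l ↦ ModuleCat.of R ((Fin l.1.1 → R) ⧸ l.1.2), fun l ↦ l.2.1, fun l ↦ l.2.2,
    fun M ↦ ⟨fun hM l ↦ htp.hom_eq_zero l.2.2 hM, fun hM ↦ ?_⟩⟩
  refine htp.torsionfree_of_single_mem_rightPerp ((h _).2 fun s hs n hn f ↦ ?_)
  have := isLE_of_mem_hrsAisle (hSU s hs)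
  obtain rfl | hn := hn.eq_or_lt
  · have := (hS s hs).finitePresentation_homologyFunctor
    obtain ⟨l, ⟨e⟩⟩ := htp.exists_finitelyPresentedTorsionQuotients _ (hSU s hs).2
    have hM' (g : (homologyFunctor (ModuleCat.{u} R) 0).obj s ⟶ M) : g = 0 := by
      refine ModuleCat.hom_ext ?_
      have := hM l (g.hom ∘ₗ e.symm.toLinearMap)
      ext x
      simpa using LinearMap.congr_fun this (e x)
    rw [← cancel_epi ((shiftFunctorZero _ ℤ).inv.app s), comp_zero]
    exact hom_single_eq_zero hM' _
  · exact shift_hom_eq_zero hn f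

end

namespace DerivedCategory

open Pretriangulated

section

variable {C : Type*} [Category C] [Abelian C] [HasDerivedCategory C]

/-- Morphisms from a projective object to the cohomology in degree `n` are induced by morphisms
in the derived category. -/
lemma exists_homologyFunctor_map_eq_of_projective {P : C} [Projective P] (Y : DerivedCategory C)
    (n : ℤ) (g : P ⟶ (homologyFunctor C n).obj Y) :
    ∃ f : (singleFunctor C n).obj P ⟶ Y, (homologyFunctor C n).map f =
      (singleFunctorCompHomologyFunctorIso C n).hom.app P ≫ g := by
  obtain ⟨A, B, _, _, i, q, d, hT⟩ := TStructure.t.exists_triangle Y n (n + 1) rfl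
  have : A.IsLE n := ⟨‹_›⟩
  have : B.IsGE (n + 1) := ⟨‹_›⟩
  obtain ⟨_, hex⟩ := exact_homologyFunctor₂ hT n
  have : Epi ((homologyFunctor C n).map i) :=
    hex.epi_f ((B.isZero_of_isGE (n + 1) n (by lia)).eq_of_tgt _ _)
  obtain ⟨A', _, M, a, p, d', hT', _⟩ := exists_triangle_to_single A n (n - 1) (by lia)
  let e := singleFunctorCompHomologyFunctorIso C n
  let g' := Projective.factorThru g ((homologyFunctor C n).map i)
  let φ : P ⟶ M := g' ≫ (homologyFunctor C n).map p ≫ e.hom.app M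
  have : (A'⟦(1 : ℤ)⟧).IsLE (n - 2) := TStructure.t.isLE_shift A' (n - 1) 1 (n - 2) (by lia)
  obtain ⟨f, hf⟩ := exists_comp_mor₂_eq hT' ((singleFunctor _ n).map φ)
    (single_hom_eq_zero_of_projective (n - 2) (by lia) _)
  have hf' : (homologyFunctor C n).map f = e.hom.app P ≫ g' := by
    rw [← cancel_mono ((homologyFunctor C n).map p), ← Functor.map_comp, ← hf]
    have := e.hom.naturality φ
    rw [← cancel_mono (e.hom.app M)]
    refine this.trans ?_
    simp [φ]
  refine ⟨f ≫ i, ?_⟩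
  rw [Functor.map_comp, hf', Category.assoc, Projective.factorThru_comp]

/-- The cone of the first morphism of a right exact sequence, seen in degree zero, computes the
last term of the sequence. -/
lemma nonempty_iso_homologyFunctor_of_exact {S : ShortComplex C} (hS : S.Exact) [Epi S.g] {n : ℤ}
    {Z : DerivedCategory C} {j : (singleFunctor C n).obj S.X₂ ⟶ Z}
    {δ : Z ⟶ ((singleFunctor C n).obj S.X₁)⟦(1 : ℤ)⟧}
    (hT : Triangle.mk ((singleFunctor C n).map S.f) j δ ∈ distTriang _) :
    Nonempty ((homologyFunctor C n).obj Z ≅ S.X₃) := by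
  let e := singleFunctorCompHomologyFunctorIso C n
  have : (((singleFunctor C n).obj S.X₁)⟦(1 : ℤ)⟧).IsLE (n - 1) :=
    TStructure.t.isLE_shift _ n 1 (n - 1) (by lia)
  obtain ⟨w, h⟩ := exact_homologyFunctor₂ hT n
  obtain ⟨w', h'⟩ := exact_homologyFunctor₂ (rot_of_distTriang _ hT) n
  have : Epi ((homologyFunctor C n).map j) := h'.epi_f
    ((isZero_of_isLE (((singleFunctor C n).obj S.X₁)⟦(1 : ℤ)⟧) (n - 1) n (by lia)).eq_of_tgt _ _)
  have w'' : S.f ≫ e.inv.app S.X₂ ≫ (homologyFunctor C n).map j = 0 := by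
    have := e.inv.naturality_assoc S.f ((homologyFunctor C n).map j)
    exact this.trans ((congr_arg (e.inv.app S.X₁ ≫ ·) w).trans comp_zero)
  have h'' : (ShortComplex.mk _ _ w'').Exact :=
    (ShortComplex.exact_iff_of_iso (S₁ := .mk _ _ w) (S₂ := .mk _ _ w'')
      (ShortComplex.isoMk (e.app S.X₁) (e.app S.X₂)
      (Iso.refl _) (e.hom.naturality S.f).symm (by simp))).1 h
  exact ⟨h''.gIsCokernel.coconePointUniqueUpToIso hS.gIsCokernel⟩

end

variable {R : Type u} [Ring R] [HasDerivedCategory.{w} (ModuleCat.{u} R)]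

lemma isGE_of_single_hom_eq_zero {Y : DerivedCategory (ModuleCat.{u} R)} (n : ℤ)
    (h : ∀ (k : ℤ) (_ : k < n) (f : (singleFunctor (ModuleCat.{u} R) k).obj (ModuleCat.of R R) ⟶ Y),
      f = 0) : Y.IsGE n := by
  refine (isGE_iff _ _).2 fun k hk ↦ ModuleCat.isZero_iff_subsingleton.2 ?_
  refine subsingleton_of_forall_eq 0 fun x ↦ ?_
  obtain ⟨f, hf⟩ := exists_homologyFunctor_map_eq_of_projective Y k
    (ModuleCat.ofHom (LinearMap.toSpanSingleton R _ x))
  rw [h k hk f, Functor.map_zero] at hf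
  have h0 : ModuleCat.ofHom (LinearMap.toSpanSingleton R
      ((homologyFunctor (ModuleCat.{u} R) k).obj Y) x) = 0 :=
    ((cancel_epi _).1 (comp_zero.trans hf)).symm
  simpa using LinearMap.congr_fun (congr_arg ModuleCat.Hom.hom h0) (1 : R)

lemma isCompactObject_single_fin (n : ℤ) (m : ℕ) :
    IsCompactObject.{w} ((singleFunctor (ModuleCat.{u} R) n).obj (ModuleCat.of R (Fin m → R))) :=
  (isCompactObject_single_pi n (ULift.{u} (Fin m))).of_iso ((singleFunctor _ n).mapIso
    (LinearEquiv.funCongrLeft R R Equiv.ulift.symm).toModuleIso)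

/-- Every finitely presented module is the top cohomology of a compact object. -/
lemma exists_isCompactObject_homologyFunctor_iso (M : ModuleCat.{u} R)
    [Module.FinitePresentation R M] : ∃ S : DerivedCategory (ModuleCat.{u} R),
      IsCompactObject.{w} S ∧ S.IsLE 0 ∧
      Nonempty ((homologyFunctor (ModuleCat.{u} R) 0).obj S ≅ M) := by
  obtain ⟨n, m, f, g, hf, hgf⟩ := Module.FinitePresentation.exists_fin' R M
  let S := ShortComplex.mk (ModuleCat.ofHom g) (ModuleCat.ofHom (Y := M) f)
    (ModuleCat.hom_ext hgf.linearMap_comp_eq_zero)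
  have hS : S.Exact := (ShortComplex.ShortExact.moduleCat_exact_iff_function_exact S).2 hgf
  have : Epi S.g := (ModuleCat.epi_iff_surjective _).2 hf
  obtain ⟨Z, j, δ, hT⟩ := distinguished_cocone_triangle ((singleFunctor _ 0).map S.f)
  have : (((singleFunctor (ModuleCat.{u} R) 0).obj S.X₁)⟦(1 : ℤ)⟧).IsLE (-1) :=
    TStructure.t.isLE_shift _ 0 1 (-1) (by lia)
  have : (((singleFunctor (ModuleCat.{u} R) 0).obj S.X₁)⟦(1 : ℤ)⟧).IsLE 0 :=
    TStructure.t.isLE_of_le _ (-1) 0 (by lia)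
  have : ((singleFunctor (ModuleCat.{u} R) 0).obj S.X₂).IsLE 0 := inferInstance
  have hT' : Triangle.mk j δ _ ∈ distTriang _ := rot_of_distTriang _ hT
  refine ⟨Z, IsCompactObject.of_distTriang _ hT' (isCompactObject_single_fin 0 n) ?_,
    isLE₂_of_distTriang hT' 0, nonempty_iso_homologyFunctor_of_exact hS hT⟩
  exact (isCompactObject_single_fin (-1) m).of_iso
    (((singleFunctors (ModuleCat.{u} R)).shiftIso 1 (-1) 0 (by lia)).symm.app _)

end DerivedCategory

open DerivedCategory

section

variable {R : Type u} [Ring R] [HasDerivedCategory.{w} (ModuleCat.{u} R)]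
  {T F : ModuleCat.{u} R → Prop}

theorem ModTorsionPair.hrsCompactlyGenerated_of_finitePresentation (htp : ModTorsionPair R T F)
    {Λ : Type*} (Tfam : Λ → ModuleCat.{u} R) (hfp : ∀ l, Module.FinitePresentation R (Tfam l))
    (hT : ∀ l, T (Tfam l))
    (hF : ∀ M : ModuleCat.{u} R, F M ↔ ∀ (l : Λ) (f : Tfam l →ₗ[R] M), f = 0) :
    HRSCompactlyGenerated R T := by
  choose S hS hS' e using fun l ↦
    have := hfp l
    exists_isCompactObject_homologyFunctor_iso (Tfam l)
  let G := (singleFunctor (ModuleCat.{u} R) (-1)).obj (ModuleCat.of R R)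
  have : G.IsLE 0 := TStructure.t.isLE_of_le _ (-1) 0 (by lia)
  have hG : G ∈ HRSAisle R T :=
    mem_hrsAisle (htp.torsion_of_isZero (G.isZero_of_isLE (-1) 0 (by lia)))
  have hU : ∀ s ∈ insert G (Set.range S), s ∈ HRSAisle R T := by
    rintro _ (rfl | ⟨l, rfl⟩)
    · exact hG
    · exact mem_hrsAisle (htp.iso_closed_torsion (e l).some.symm (hT l))
  refine ⟨insert G (Set.range S), ?_, hU, fun Y ↦
    ⟨fun hY s hs n hn ↦ hY _ (htp.shift_mem_hrsAisle (hU s hs) hn), fun hY ↦ ?_⟩⟩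
  · rintro _ (rfl | ⟨l, rfl⟩)
    · exact isCompactObject_single _
    · exact hS l
  have : Y.IsGE 0 := isGE_of_single_hom_eq_zero 0 fun k hk f ↦ by
    let i := (singleFunctors (ModuleCat.{u} R)).shiftIso (-1 - k) k (-1) (by lia)
    rw [← cancel_epi (i.hom.app _), comp_zero]
    exact hY G (Set.mem_insert _ _) (-1 - k) (by lia) _
  refine htp.mem_rightPerp_hrsAisle ((hF _).2 fun l g ↦ ?_)
  obtain ⟨f, hf⟩ := homologyFunctor_map_surjective_of_isLE_of_isGE (X := S l) (Y := Y) 0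
    ((e l).some.hom ≫ ModuleCat.ofHom g)
  have hf0 : f = 0 := by
    rw [← cancel_epi ((shiftFunctorZero _ ℤ).hom.app (S l)), comp_zero]
    exact hY _ (Set.mem_insert_of_mem _ ⟨l, rfl⟩) 0 le_rfl _
  rw [hf0, Functor.map_zero] at hf
  have h0 : ModuleCat.ofHom g = 0 := ((cancel_epi _).1 (comp_zero.trans hf)).symm
  exact congr_arg ModuleCat.Hom.hom h0

end

/-- **Theorem (characterization of tCG torsion pairs).** For a torsion pair `(T, F)` in
`R`-Mod, the associated Happel-Reiten-Smalø t-structure on `D(R)` is compactly generated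
if and only if there is a set of finitely presented modules in `T` whose simultaneous
`Hom`-vanishing cuts out exactly `F`. -/
theorem hrs_compactly_generated_iff_exists_fp_set
    (T F : ModuleCat.{u} R → Prop) (htp : ModTorsionPair R T F) :
    HRSCompactlyGenerated R T ↔
      ∃ (Λ : Type u) (Tfam : Λ → ModuleCat.{u} R),
        (∀ l, Module.FinitePresentation R (Tfam l)) ∧ (∀ l, T (Tfam l)) ∧
        ∀ M : ModuleCat.{u} R, F M ↔ ∀ (l : Λ) (f : Tfam l →ₗ[R] M), f = 0 := by
  exact ⟨htp.exists_finitePresentation_of_hrsCompactlyGenerated,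
    fun ⟨_, Tfam, hfp, hT, hF⟩ ↦ htp.hrsCompactlyGenerated_of_finitePresentation Tfam hfp hT hF⟩
end

section
/- Let R be an associative unital ring and let (𝒯,ℱ) be a torsion pair in R-Mod such that 𝒯 = Gen(V) for some finitely presented left R-module V. Then the Happel–Reiten–Smalø t-structure associated to (𝒯,ℱ) on the unbounded derived category D(R) is compactly generated. -/
open CategoryTheory Limits DirectSum

universe w u

variable (R : Type u) [Ring R] [HasDerivedCategory.{w} (ModuleCat.{u} R)]

/-- `M` is `V`-generated: some coproduct of copies of `V` surjects onto `M`. -/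
def GenBy (V M : ModuleCat.{u} R) : Prop :=
  ∃ (I : Type u) (p : (⨁ _ : I, V) →ₗ[R] M), Function.Surjective p

section DerivedCategory

open DerivedCategory Pretriangulated

universe w' v' u'

variable {C : Type u'} [Category.{v'} C] [Abelian C]

/-- A morphism from the homology of a cochain complex to an injective object is induced by a
morphism to a single complex. -/
lemma CochainComplex.exists_homologyMap_to_single (K : CochainComplex C ℤ) (n : ℤ) (E : C)
    [Injective E] (φ : K.homology n ⟶ ((HomologicalComplex.single C (.up ℤ) n).obj E).homology n) :
    ∃ f : K ⟶ (HomologicalComplex.single C (.up ℤ) n).obj E,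
      HomologicalComplex.homologyMap f n = φ := by
  let e := HomologicalComplex.singleObjHomologySelfIso (.up ℤ) n E
  let ψ : K.opcycles n ⟶ E := Injective.factorThru (φ ≫ e.hom) (K.homologyι n)
  refine ⟨HomologicalComplex.mkHomToSingle (K.pOpcycles n ≫ ψ) (by simp), ?_⟩
  rw [← cancel_mono (HomologicalComplex.homologyι _ n), HomologicalComplex.homologyι_naturality]
  have h : HomologicalComplex.opcyclesMap
      (HomologicalComplex.mkHomToSingle (c := .up ℤ) (K.pOpcycles n ≫ ψ) (by simp)) n =
      ψ ≫ (HomologicalComplex.singleObjOpcyclesSelfIso (.up ℤ) n E).hom := by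
    rw [← cancel_epi (K.pOpcycles n), HomologicalComplex.p_opcyclesMap]
    simp [HomologicalComplex.singleObjOpcyclesSelfIso_hom]
  erw [h]
  rw [← Category.assoc, Injective.comp_factorThru, Category.assoc]
  erw [HomologicalComplex.singleObjHomologySelfIso_hom_singleObjOpcyclesSelfIso_hom]

/-- A morphism from a projective object to the homology of a cochain complex is induced by a
morphism from a single complex. -/
lemma CochainComplex.exists_homologyMap_from_single (K : CochainComplex C ℤ) (n : ℤ) (P : C)
    [Projective P] (φ : ((HomologicalComplex.single C (.up ℤ) n).obj P).homology n ⟶ K.homology n) :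
    ∃ f : (HomologicalComplex.single C (.up ℤ) n).obj P ⟶ K,
      HomologicalComplex.homologyMap f n = φ := by
  let e := HomologicalComplex.singleObjHomologySelfIso (.up ℤ) n P
  let ψ : P ⟶ K.cycles n := Projective.factorThru (e.inv ≫ φ) (K.homologyπ n)
  refine ⟨HomologicalComplex.mkHomFromSingle (ψ ≫ K.iCycles n) (by simp), ?_⟩
  rw [← cancel_epi (HomologicalComplex.homologyπ _ n), HomologicalComplex.homologyπ_naturality]
  have h : HomologicalComplex.cyclesMap
      (HomologicalComplex.mkHomFromSingle (c := .up ℤ) (ψ ≫ K.iCycles n) (by simp)) n =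
      (HomologicalComplex.singleObjCyclesSelfIso (.up ℤ) n P).hom ≫ ψ := by
    rw [← cancel_mono (K.iCycles n), HomologicalComplex.cyclesMap_i]
    simp [HomologicalComplex.singleObjCyclesSelfIso_hom]
  erw [h]
  rw [Category.assoc, Projective.factorThru_comp]
  erw [HomologicalComplex.singleObjHomologySelfIso_hom_singleObjHomologySelfIso_inv_assoc]

namespace DerivedCategory

variable [HasDerivedCategory.{w'} C]

/-- If every morphism on homology in degree `n` lifts to a morphism of cochain complexes, the same
holds in the derived category. -/
lemma exists_homologyFunctor_map_eq {X Y : DerivedCategory C} {K L : CochainComplex C ℤ}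
    (e : Q.obj K ≅ X) (e' : Q.obj L ≅ Y) {n : ℤ}
    (h : ∀ ψ : K.homology n ⟶ L.homology n,
      ∃ f : K ⟶ L, HomologicalComplex.homologyMap f n = ψ)
    (φ : (homologyFunctor C n).obj X ⟶ (homologyFunctor C n).obj Y) :
    ∃ f : X ⟶ Y, (homologyFunctor C n).map f = φ := by
  obtain ⟨f, hf⟩ := h ((homologyFunctorFactors C n).inv.app K ≫
    (homologyFunctor C n).map e.hom ≫ φ ≫ (homologyFunctor C n).map e'.inv ≫
      (homologyFunctorFactors C n).hom.app L)
  have hQ : (homologyFunctor C n).map (Q.map f) =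
      (homologyFunctor C n).map e.hom ≫ φ ≫ (homologyFunctor C n).map e'.inv := by
    rw [← cancel_mono ((homologyFunctorFactors C n).hom.app L),
      homologyFunctorFactors_hom_naturality, hf]
    erw [Iso.hom_inv_id_app_assoc]
    simp only [Category.assoc]
    rfl
  refine ⟨e.inv ≫ Q.map f ≫ e'.hom, ?_⟩
  rw [Functor.map_comp, Functor.map_comp, hQ]
  simp only [Category.assoc]
  rw [← Functor.map_comp, e'.inv_hom_id, ← Functor.map_comp_assoc, e.inv_hom_id]
  simp

lemma exists_homologyFunctor_map_to_single (X : DerivedCategory C) (n : ℤ) (E : C) [Injective E]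
    (φ : (homologyFunctor C n).obj X ⟶ (homologyFunctor C n).obj ((singleFunctor C n).obj E)) :
    ∃ f : X ⟶ (singleFunctor C n).obj E, (homologyFunctor C n).map f = φ :=
  exists_homologyFunctor_map_eq (Q.objObjPreimageIso X) ((singleFunctorIsoCompQ C n).symm.app E)
    (CochainComplex.exists_homologyMap_to_single _ n E) φ

lemma exists_homologyFunctor_map_from_single (X : DerivedCategory C) (n : ℤ) (P : C)
    [Projective P]
    (φ : (homologyFunctor C n).obj ((singleFunctor C n).obj P) ⟶ (homologyFunctor C n).obj X) :
    ∃ f : (singleFunctor C n).obj P ⟶ X, (homologyFunctor C n).map f = φ :=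
  exists_homologyFunctor_map_eq ((singleFunctorIsoCompQ C n).symm.app P) (Q.objObjPreimageIso X)
    (CochainComplex.exists_homologyMap_from_single _ n P) φ

lemma isIso_of_isIso_homologyFunctor_map_single {n : ℤ} {A B : C}
    (f : (singleFunctor C n).obj A ⟶ (singleFunctor C n).obj B)
    [IsIso ((homologyFunctor C n).map f)] : IsIso f := by
  obtain ⟨α, rfl⟩ := (singleFunctor C n).map_surjective f
  have : IsIso α := (NatIso.isIso_map_iff (singleFunctorCompHomologyFunctorIso C n) α).1
    (by dsimp; infer_instance)
  infer_instance

/-- A morphism to an injective object, placed in degree `n`, vanishes as soon as it vanishes on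
homology in degree `n`. -/
lemma eq_zero_of_homologyFunctor_map_to_single {X : DerivedCategory C} {n : ℤ} {E : C}
    [Injective E] (f : X ⟶ (singleFunctor C n).obj E) (hf : (homologyFunctor C n).map f = 0) :
    f = 0 := by
  obtain ⟨Z, g, δ, hT⟩ := distinguished_cocone_triangle f
  have : Injective ((homologyFunctor C n).obj ((singleFunctor C n).obj E)) :=
    Injective.of_iso ((singleFunctorCompHomologyFunctorIso C n).symm.app E) ‹_›
  have : Mono ((homologyFunctor C n).map g) :=
    (HomologySequence.mono_homologyMap_mor₂_iff _ hT n).2 hf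
  obtain ⟨r, hr⟩ := exists_homologyFunctor_map_to_single Z n E
    (Injective.factorThru (𝟙 _) ((homologyFunctor C n).map g))
  have : IsIso ((homologyFunctor C n).map (g ≫ r)) := by
    rw [Functor.map_comp, hr, Injective.comp_factorThru]
    infer_instance
  have := isIso_of_isIso_homologyFunctor_map_single (g ≫ r)
  have hfg : f ≫ g = 0 := comp_distTriang_mor_zero₁₂ _ hT
  rw [← cancel_mono (g ≫ r), zero_comp, reassoc_of% hfg, zero_comp]

/-- A morphism from a projective object, placed in degree `n`, vanishes as soon as it vanishes on
homology in degree `n`. -/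
lemma eq_zero_of_homologyFunctor_map_from_single {X : DerivedCategory C} {n : ℤ} {P : C}
    [Projective P] (f : (singleFunctor C n).obj P ⟶ X) (hf : (homologyFunctor C n).map f = 0) :
    f = 0 := by
  obtain ⟨Z, g, δ, hT⟩ := distinguished_cocone_triangle₁ f
  have : Projective ((homologyFunctor C n).obj ((singleFunctor C n).obj P)) :=
    Projective.of_iso ((singleFunctorCompHomologyFunctorIso C n).symm.app P) ‹_›
  have : Epi ((homologyFunctor C n).map g) :=
    (HomologySequence.epi_homologyMap_mor₁_iff _ hT n).2 hf
  obtain ⟨r, hr⟩ := exists_homologyFunctor_map_from_single Z n P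
    (Projective.factorThru (𝟙 _) ((homologyFunctor C n).map g))
  have : IsIso ((homologyFunctor C n).map (r ≫ g)) := by
    rw [Functor.map_comp, hr, Projective.factorThru_comp]
    infer_instance
  have := isIso_of_isIso_homologyFunctor_map_single (r ≫ g)
  have hgf : g ≫ f = 0 := comp_distTriang_mor_zero₁₂ _ hT
  rw [← cancel_epi (r ≫ g), comp_zero, Category.assoc, hgf, comp_zero]

/-- A morphism from an object `≤ n` to an object `≥ n` is detected by homology in degree `n`. -/
lemma eq_zero_of_isLE_of_isGE [EnoughInjectives C] {X Y : DerivedCategory C} (f : X ⟶ Y) (n : ℤ)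
    [X.IsLE n] [Y.IsGE n] (hf : (homologyFunctor C n).map f = 0) : f = 0 := by
  let E := Injective.under ((homologyFunctor C n).obj Y)
  let e := (singleFunctorCompHomologyFunctorIso C n).app E
  obtain ⟨g, hg⟩ := exists_homologyFunctor_map_to_single Y n E (Injective.ι _ ≫ e.inv)
  obtain ⟨Z, i, δ, hT⟩ := distinguished_cocone_triangle₁ g
  have h₀ : f ≫ g = 0 := eq_zero_of_homologyFunctor_map_to_single _ (by simp [hf])
  obtain ⟨k, hk⟩ : ∃ k : X ⟶ Z, f = k ≫ i := Triangle.coyoneda_exact₂ _ hT f h₀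
  have hmono : Mono ((homologyFunctor C n).map g) := by
    rw [hg]
    exact mono_comp _ _
  have hZ : Z.IsGE (n + 1) := by
    rw [isGE_iff]
    intro j hj
    have hjn : j ≤ n := by lia
    have hδ : HomologySequence.δ (Triangle.mk i g δ) (j - 1) j = 0 :=
      (isZero_of_isGE ((singleFunctor C n).obj E) n _ (by lia)).eq_of_src _ _
    have hi : (homologyFunctor C j).map i = 0 := by
      obtain hjn | rfl := hjn.lt_or_eq
      · exact (isZero_of_isGE Y n _ hjn).eq_of_tgt _ _
      · exact (HomologySequence.mono_homologyMap_mor₂_iff _ hT j).1 hmono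
    exact (HomologySequence.exact₁ _ hT (j - 1) j).isZero_of_both_zeros hδ hi
  have hk' : k = 0 := TStructure.t.zero k n (n + 1)
  rw [hk, hk', zero_comp]

end DerivedCategory

end DerivedCategory

section Compact

open Pretriangulated

variable {D : Type*} [Category D] [Preadditive D]

/-- Every morphism from `S` to the point of the cofan `c` is a finite sum of morphisms which factor
through the inclusions of `c`. -/
def HomSpannedByInj {I : Type*} {Y : I → D} (c : Cofan Y) (S : D) : Prop :=
  ∀ f : S ⟶ c.pt, ∃ (s : Finset I) (g : ∀ i, S ⟶ Y i), f = ∑ i ∈ s, g i ≫ c.inj i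

/-- The projections of a coproduct onto its summands. -/
lemma CategoryTheory.Limits.Cofan.IsColimit.exists_proj {I : Type*} [DecidableEq I] {Y : I → D}
    {c : Cofan Y} (hc : IsColimit c) (i : I) :
    ∃ p : c.pt ⟶ Y i, c.inj i ≫ p = 𝟙 _ ∧ ∀ j, j ≠ i → c.inj j ≫ p = 0 :=
  ⟨Cofan.IsColimit.desc hc (Pi.single (M := fun j => Y j ⟶ Y i) i (𝟙 (Y i))),
    by rw [Cofan.IsColimit.fac, Pi.single_eq_same],
    fun j hj => by rw [Cofan.IsColimit.fac, Pi.single_eq_of_ne hj]⟩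

lemma CategoryTheory.Limits.Cofan.IsColimit.eq_zero_of_sum_comp_inj {I : Type*} {Y : I → D}
    {c : Cofan Y} (hc : IsColimit c) {S : D} (s : Finset I) (g : ∀ i, S ⟶ Y i)
    (h : ∑ i ∈ s, g i ≫ c.inj i = 0) {i : I} (hi : i ∈ s) : g i = 0 := by
  classical
  obtain ⟨p, hp, hp'⟩ := Cofan.IsColimit.exists_proj hc i
  have := congr($h ≫ p)
  rw [zero_comp, Preadditive.sum_comp, Finset.sum_eq_single_of_mem i hi] at this
  · simpa [hp] using this
  · intro j _ hj
    rw [Category.assoc, hp' j hj, comp_zero]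

lemma isCompactObject_of_homSpannedByInj {S : D}
    (h : ∀ (I : Type w) (Y : I → D) (c : Cofan Y), IsColimit c → HomSpannedByInj c S) :
    IsCompactObject.{w} S := by
  intro I _ Y c hc
  refine ⟨(injective_iff_map_eq_zero _).2 fun x hx => ?_, fun f => ?_⟩
  · ext i
    obtain ⟨p, hp, hp'⟩ := Cofan.IsColimit.exists_proj hc i
    have key : (Preadditive.rightComp S p).comp
        (DirectSum.toAddMonoid (fun i => Preadditive.rightComp S (c.inj i))) =
        (DFinsupp.evalAddMonoidHom i : (⨁ i, (S ⟶ Y i)) →+ _) := by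
      refine DirectSum.addHom_ext fun j g => ?_
      rw [AddMonoidHom.comp_apply, DirectSum.toAddMonoid_of]
      by_cases hj : j = i
      · subst hj
        refine Eq.trans ?_ (DirectSum.of_eq_same (β := fun i => (S ⟶ Y i)) j g).symm
        simp [hp, Preadditive.rightComp]
      · refine Eq.trans ?_ (DirectSum.of_eq_of_ne (β := fun i => (S ⟶ Y i)) j i g (Ne.symm hj)).symm
        simp [hp' j hj, Preadditive.rightComp]
    have := DFunLike.congr_fun key x
    rw [AddMonoidHom.comp_apply, hx, map_zero] at this
    exact this.symm
  · obtain ⟨s, g, rfl⟩ := h I Y c hc f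
    refine ⟨∑ i ∈ s, DirectSum.of (fun i => (S ⟶ Y i)) i (g i), ?_⟩
    rw [map_sum]
    simp [Preadditive.rightComp]

lemma HomSpannedByInj.of_iso {I : Type*} {Y : I → D} {c : Cofan Y} {S S' : D} (e : S ≅ S')
    (h : HomSpannedByInj c S) : HomSpannedByInj c S' := by
  intro f
  obtain ⟨s, g, hg⟩ := h (e.hom ≫ f)
  refine ⟨s, fun i => e.inv ≫ g i, ?_⟩
  simp [← Preadditive.comp_sum, ← hg]

lemma HomSpannedByInj.of_distinguished [HasZeroObject D] [HasShift D ℤ]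
    [∀ n : ℤ, (shiftFunctor D n).Additive] [Pretriangulated D] {I : Type*} {Y : I → D}
    {c : Cofan Y} (hc : IsColimit c) (T : Triangle D) (hT : T ∈ distTriang D)
    (h₁ : HomSpannedByInj c (T.obj₁⟦(1 : ℤ)⟧)) (h₂ : HomSpannedByInj c T.obj₂) :
    HomSpannedByInj c T.obj₃ := by
  classical
  intro f
  obtain ⟨s, g, hg⟩ := h₂ (T.mor₂ ≫ f)
  have hzero : ∑ i ∈ s, (T.mor₁ ≫ g i) ≫ c.inj i = 0 := by
    simp only [Category.assoc, ← Preadditive.comp_sum, ← hg]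
    rw [comp_distTriang_mor_zero₁₂_assoc _ hT, zero_comp]
  have hlift (i : I) : ∃ k : T.obj₃ ⟶ Y i, i ∈ s → g i = T.mor₂ ≫ k := by
    by_cases hi : i ∈ s
    · obtain ⟨k, hk⟩ := Triangle.yoneda_exact₂ _ hT (g i)
        (Cofan.IsColimit.eq_zero_of_sum_comp_inj hc s _ hzero hi)
      exact ⟨k, fun _ => hk⟩
    · exact ⟨0, fun h => (hi h).elim⟩
  choose k hk using hlift
  obtain ⟨l, hl⟩ := Triangle.yoneda_exact₃ _ hT (f - ∑ i ∈ s, k i ≫ c.inj i) (by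
    rw [Preadditive.comp_sub, hg, Preadditive.comp_sum, sub_eq_zero]
    exact Finset.sum_congr rfl fun i hi => by rw [hk i hi, Category.assoc])
  obtain ⟨t, m, rfl⟩ := h₁ l
  refine ⟨s ∪ t, fun i => (if i ∈ s then k i else 0) + if i ∈ t then T.mor₃ ≫ m i else 0, ?_⟩
  rw [eq_add_of_sub_eq' hl]
  simp only [Preadditive.add_comp, Finset.sum_add_distrib, ite_comp, zero_comp,
    Finset.sum_ite_mem, Finset.union_inter_cancel_left, Finset.union_inter_cancel_right,
    Preadditive.comp_sum, Category.assoc]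

end Compact

section ModuleCat

open DerivedCategory Pretriangulated

variable {R}

/-- Homology of a coproduct in the derived category is generated by the homology of its summands. -/
lemma DerivedCategory.iSup_range_homologyFunctor_map_inj_eq_top {I : Type*}
    {Y : I → DerivedCategory (ModuleCat.{u} R)} {c : Cofan Y} (hc : IsColimit c) (n : ℤ) :
    ⨆ i, LinearMap.range ((homologyFunctor (ModuleCat.{u} R) n).map (c.inj i)).hom = ⊤ := by
  set H := homologyFunctor (ModuleCat.{u} R) n
  set N := ⨆ i, LinearMap.range (H.map (c.inj i)).hom
  let E := Injective.under (ModuleCat.of R (H.obj c.pt ⧸ N))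
  let e := (singleFunctorCompHomologyFunctorIso (ModuleCat.{u} R) n).app E
  obtain ⟨f, hf⟩ := exists_homologyFunctor_map_to_single c.pt n E
    (ModuleCat.ofHom N.mkQ ≫ Injective.ι _ ≫ e.inv)
  have hN (i : I) : H.map (c.inj i) ≫ ModuleCat.ofHom N.mkQ = 0 := by
    ext x
    exact (Submodule.Quotient.mk_eq_zero N).2
      (Submodule.mem_iSup_of_mem i (LinearMap.mem_range_self _ x))
  have hf₀ : f = 0 := Cofan.IsColimit.hom_ext hc _ _ fun i => by
    rw [comp_zero]
    refine eq_zero_of_homologyFunctor_map_to_single _ ?_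
    rw [Functor.map_comp, hf, reassoc_of% (hN i), zero_comp]
  have hN₀ : ModuleCat.ofHom N.mkQ = 0 := by
    rw [← cancel_mono (Injective.ι (ModuleCat.of R (H.obj c.pt ⧸ N)) ≫ e.inv), zero_comp, ← hf,
      hf₀, Functor.map_zero]
  rw [← N.ker_mkQ, LinearMap.ker_eq_top]
  exact congr(($hN₀).hom)

lemma DerivedCategory.homSpannedByInj_single {I : Type*}
    {Y : I → DerivedCategory (ModuleCat.{u} R)} {c : Cofan Y} (hc : IsColimit c) (n : ℤ)
    (P : ModuleCat.{u} R) [Module.Projective R P] [Module.Finite R P] :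
    HomSpannedByInj c ((singleFunctor (ModuleCat.{u} R) n).obj P) := by
  classical
  intro f
  set H := homologyFunctor (ModuleCat.{u} R) n
  let e := (singleFunctorCompHomologyFunctorIso (ModuleCat.{u} R) n).app P
  have : Projective P := P.projective_of_categoryTheory_projective
  let φ : P →ₗ[R] H.obj c.pt := (e.inv ≫ H.map f).hom
  obtain ⟨s, hs⟩ := CompleteLattice.IsCompactElement.exists_finset_of_le_iSup _
    ((Submodule.fg_iff_compact _).1 (Module.Finite.fg_top.map φ))
    (fun i => LinearMap.range (H.map (c.inj i)).hom)
    (by rw [iSup_range_homologyFunctor_map_inj_eq_top hc]; exact le_top)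
  let σ : (∀ i : s, H.obj (Y i)) →ₗ[R] H.obj c.pt :=
    ∑ i : s, (H.map (c.inj i.1)).hom ∘ₗ LinearMap.proj i
  have hσ (x : P) : φ x ∈ LinearMap.range σ := by
    obtain ⟨μ, hμ⟩ := (Submodule.mem_iSup_finset_iff_exists_sum _ _).1
      (hs (Submodule.mem_map_of_mem (f := φ) (Submodule.mem_top (x := x))))
    choose y hy using fun i => (μ i).2
    refine ⟨fun i => y i, ?_⟩
    rw [← hμ, ← Finset.sum_coe_sort]
    simp [σ, hy]
  obtain ⟨ψ, hψ⟩ := Module.projective_lifting_property σ.rangeRestrict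
    (φ.codRestrict _ hσ) σ.surjective_rangeRestrict
  have hlift (i : I) : ∃ g : (singleFunctor (ModuleCat.{u} R) n).obj P ⟶ Y i,
      ∀ hi : i ∈ s, H.map g = e.hom ≫ ModuleCat.ofHom (LinearMap.proj ⟨i, hi⟩ ∘ₗ ψ) := by
    by_cases hi : i ∈ s
    · obtain ⟨g, hg⟩ := exists_homologyFunctor_map_from_single (Y i) n P
        (e.hom ≫ ModuleCat.ofHom (LinearMap.proj (⟨i, hi⟩ : s) ∘ₗ ψ))
      exact ⟨g, fun _ => hg⟩
    · exact ⟨0, fun h => (hi h).elim⟩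
  choose g hg using hlift
  refine ⟨s, g, ?_⟩
  rw [← sub_eq_zero]
  refine eq_zero_of_homologyFunctor_map_from_single _ ?_
  rw [Functor.map_sub, sub_eq_zero, Functor.map_sum, ← cancel_epi e.inv, Preadditive.comp_sum,
    ← Finset.sum_coe_sort]
  ext x
  have h₁ : σ (ψ x) = φ x := congr_arg Subtype.val (LinearMap.congr_fun hψ x)
  have h₂ (i : s) : e.inv ≫ H.map (g i ≫ c.inj i) =
      ModuleCat.ofHom (LinearMap.proj i ∘ₗ ψ) ≫ H.map (c.inj i.1) := by
    rw [Functor.map_comp, hg i i.2, Category.assoc, Iso.inv_hom_id_assoc]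
  rw [Finset.sum_congr rfl fun i _ => h₂ i]
  refine h₁.symm.trans ?_
  simp [σ]

variable {V M N : ModuleCat.{u} R}

lemma GenBy.of_surjective (hM : GenBy R V M) (f : M →ₗ[R] N) (hf : Function.Surjective f) :
    GenBy R V N := by
  obtain ⟨I, p, hp⟩ := hM
  exact ⟨I, f ∘ₗ p, hf.comp hp⟩

variable (V) in
lemma GenBy.refl : GenBy R V V :=
  ⟨PUnit, DirectSum.toModule R _ _ fun _ => LinearMap.id, fun x =>
    ⟨DirectSum.lof R _ _ PUnit.unit x, by simp⟩⟩

lemma GenBy.of_isZero (hM : IsZero M) : GenBy R V M :=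
  (GenBy.refl V).of_surjective 0 fun x => ⟨0, by
    have := ModuleCat.subsingleton_of_isZero hM
    exact Subsingleton.elim _ _⟩

lemma GenBy.hom_eq_zero (hM : GenBy R V M) (h : ∀ v : V ⟶ N, v = 0) (f : M ⟶ N) : f = 0 := by
  classical
  obtain ⟨I, p, hp⟩ := hM
  have key : f.hom ∘ₗ p = 0 := by
    refine DirectSum.linearMap_ext R fun i => ?_
    exact congrArg ModuleCat.Hom.hom
      (h (ModuleCat.ofHom ((f.hom ∘ₗ p) ∘ₗ DirectSum.lof R I (fun _ => V) i)))
  ext x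
  obtain ⟨y, rfl⟩ := hp x
  exact LinearMap.congr_fun key y

namespace DerivedCategory

/-- The homology functors are compatible with shifts. -/
noncomputable def homologyShiftIso {C : Type*} [Category C] [Abelian C]
    [HasDerivedCategory.{w} C] (X : DerivedCategory C) (n k m : ℤ) (h : n + k = m) :
    (homologyFunctor C k).obj (X⟦n⟧) ≅ (homologyFunctor C m).obj X :=
  ((homologyFunctor C 0).shiftIso n k m h).app X

lemma shift_mem_HRSAisle {T : ModuleCat.{u} R → Prop} (hT : ∀ M : ModuleCat.{u} R, T M ↔ GenBy R V M)
    {X : DerivedCategory (ModuleCat.{u} R)} (hX : X ∈ HRSAisle R T) {n : ℤ} (hn : 0 ≤ n) :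
    (X⟦n⟧ : DerivedCategory (ModuleCat.{u} R)) ∈ HRSAisle R T := by
  refine ⟨fun k hk => (hX.1 (n + k) (by lia)).of_iso (homologyShiftIso X n k _ rfl), ?_⟩
  rw [hT]
  let e := homologyShiftIso X n 0 n (by simp)
  obtain hn | rfl := hn.lt_or_eq
  · exact .of_isZero ((hX.1 n hn).of_iso e)
  · exact ((hT _).1 hX.2).of_surjective e.inv.hom ((ModuleCat.epi_iff_surjective _).1 inferInstance)

lemma single_neg_one_mem_HRSAisle {T : ModuleCat.{u} R → Prop}
    (hT : ∀ M : ModuleCat.{u} R, T M ↔ GenBy R V M) :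
    (singleFunctor (ModuleCat.{u} R) (-1)).obj (ModuleCat.of R R) ∈ HRSAisle R T :=
  ⟨fun k hk => isZero_of_isLE _ (-1) k (by lia),
    (hT _).2 (.of_isZero (isZero_of_isLE _ (-1) 0 (by lia)))⟩

/-- An object with no nonzero morphism from the nonnegative shifts of `R`, placed in degree `-1`,
is concentrated in nonnegative degrees. -/
lemma isGE_zero_of_forall_hom_eq_zero {Y : DerivedCategory (ModuleCat.{u} R)}
    (h : ∀ n : ℤ, 0 ≤ n → ∀ f : (((singleFunctor (ModuleCat.{u} R) (-1)).obj
      (ModuleCat.of R R))⟦n⟧ : DerivedCategory (ModuleCat.{u} R)) ⟶ Y, f = 0) : Y.IsGE 0 := by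
  rw [isGE_iff]
  intro k hk
  let S := (singleFunctor (ModuleCat.{u} R) k).obj (ModuleCat.of R R)
  let e₁ := ((singleFunctors (ModuleCat.{u} R)).shiftIso (-1 - k) k (-1) (by lia)).app
    (ModuleCat.of R R)
  let e := (singleFunctorCompHomologyFunctorIso (ModuleCat.{u} R) k).app (ModuleCat.of R R)
  rw [ModuleCat.isZero_iff_subsingleton]
  refine subsingleton_of_forall_eq 0 fun y => ?_
  obtain ⟨f, hf⟩ := exists_homologyFunctor_map_from_single Y k (ModuleCat.of R R)
    (e.hom ≫ ModuleCat.ofHom (LinearMap.toSpanSingleton R _ y))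
  have hf₀ : f = 0 := by
    rw [← cancel_epi e₁.hom, comp_zero]
    exact h _ (by lia) _
  rw [hf₀, Functor.map_zero, ← cancel_epi e.inv, comp_zero, Iso.inv_hom_id_assoc] at hf
  simpa using (congr(($hf).hom (1 : R))).symm

end DerivedCategory

/-- A finitely presented module `V` is a quotient of the zeroth homology of a compact object `S`
concentrated in nonpositive degrees, such that every morphism from `V` to the zeroth homology of
an object receiving no nonzero morphism from `S` vanishes. -/
lemma exists_presentation_complex (V : ModuleCat.{u} R) (hV : Module.FinitePresentation R V) :
    ∃ S : DerivedCategory (ModuleCat.{u} R), IsCompactObject.{w} S ∧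
      (∀ k : ℤ, 0 < k → IsZero ((homologyFunctor (ModuleCat.{u} R) k).obj S)) ∧
      GenBy R V ((homologyFunctor (ModuleCat.{u} R) 0).obj S) ∧
      ∀ Y : DerivedCategory (ModuleCat.{u} R), (∀ f : S ⟶ Y, f = 0) →
        ∀ v : V ⟶ (homologyFunctor (ModuleCat.{u} R) 0).obj Y, v = 0 := by
  obtain ⟨n, m, q, d, hq, hdq⟩ := Module.FinitePresentation.exists_fin' R V
  set H := homologyFunctor (ModuleCat.{u} R)
  let P := ModuleCat.of R (Fin n → R)
  let P' := ModuleCat.of R (Fin m → R)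
  let d' : P' ⟶ P := ModuleCat.ofHom d
  let q' : P ⟶ V := ModuleCat.ofHom q
  have hdq' : d' ≫ q' = 0 :=
    ModuleCat.hom_ext (LinearMap.ext fun x => hdq.apply_apply_eq_zero x)
  have hepi : Epi q' := (ModuleCat.epi_iff_surjective _).2 hq
  have hP : Projective P := P.projective_of_categoryTheory_projective
  let F := singleFunctor (ModuleCat.{u} R) 0
  let e := singleFunctorCompHomologyFunctorIso (ModuleCat.{u} R) 0
  have he : e.inv.app P' ≫ (H 0).map (F.map d') = d' ≫ e.inv.app P := (e.inv.naturality d').symm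
  have he' : (H 0).map (F.map d') ≫ e.hom.app P = e.hom.app P' ≫ d' := e.hom.naturality d'
  obtain ⟨S, g, δ, hT⟩ := distinguished_cocone_triangle (F.map d')
  have hdg : F.map d' ≫ g = 0 := comp_distTriang_mor_zero₁₂ _ hT
  refine ⟨S, isCompactObject_of_homSpannedByInj fun I Y c hc => ?_, fun k hk => ?_, ?_,
    fun Y hY v => ?_⟩
  · refine HomSpannedByInj.of_distinguished hc _ hT ?_ (homSpannedByInj_single hc 0 P)
    exact (homSpannedByInj_single hc (-1) P').of_iso
      (((singleFunctors (ModuleCat.{u} R)).shiftIso 1 (-1) 0 (by lia)).symm.app P')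
  · exact (HomologySequence.exact₃ _ hT k (k + 1)).isZero_of_both_zeros
      ((isZero_of_isLE (F.obj P) 0 k hk).eq_of_src _ _)
      ((isZero_of_isLE (F.obj P') 0 (k + 1) (by lia)).eq_of_tgt _ _)
  · have hg : Epi ((H 0).map g) :=
      (HomologySequence.epi_homologyMap_mor₂_iff _ hT 0 1).2
        ((isZero_of_isLE (F.obj P') 0 1 (by lia)).eq_of_tgt _ _)
    have hker : LinearMap.ker q ≤ LinearMap.ker (e.inv.app P ≫ (H 0).map g).hom := by
      intro x hx
      obtain ⟨y, rfl⟩ := (hdq x).1 hx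
      have : d' ≫ e.inv.app P ≫ (H 0).map g = 0 := by
        rw [← reassoc_of% he, ← Functor.map_comp, hdg, Functor.map_zero, comp_zero]
      exact congr(($this).hom y)
    let p : V →ₗ[R] (H 0).obj S :=
      (LinearMap.ker q).liftQ _ hker ∘ₗ (q.quotKerEquivOfSurjective hq).symm.toLinearMap
    refine (GenBy.refl V).of_surjective p fun z => ?_
    have hsurj := (ModuleCat.epi_iff_surjective (e.inv.app P ≫ (H 0).map g)).1 (epi_comp _ _)
    obtain ⟨x, hx⟩ : ∃ x : Fin n → R, (e.inv.app P ≫ (H 0).map g).hom x = z := hsurj z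
    refine ⟨q x, ?_⟩
    rw [← hx]
    have : (q.quotKerEquivOfSurjective hq).symm (q x) = (LinearMap.ker q).mkQ x := by
      rw [LinearEquiv.symm_apply_eq]
      rfl
    simp only [p, LinearMap.comp_apply, LinearEquiv.coe_coe, this]
    rfl
  · obtain ⟨f, hf⟩ := exists_homologyFunctor_map_from_single Y 0 P (e.hom.app P ≫ q' ≫ v)
    have hdf : F.map d' ≫ f = 0 := by
      have : Projective P' := P'.projective_of_categoryTheory_projective
      refine eq_zero_of_homologyFunctor_map_from_single _ ?_
      rw [Functor.map_comp, hf, reassoc_of% he', reassoc_of% hdq', zero_comp, comp_zero]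
    obtain ⟨k, hk⟩ : ∃ k : S ⟶ Y, f = g ≫ k := Triangle.yoneda_exact₂ _ hT f hdf
    rw [hk, hY k, comp_zero, Functor.map_zero] at hf
    rw [← cancel_epi q', comp_zero, ← cancel_epi (e.hom.app P), comp_zero, hf]

end ModuleCat

/-- **Corollary.** If `(T, F)` is a torsion pair with `T = Gen(V)` for some finitely
presented module `V`, then the associated Happel-Reiten-Smalø t-structure on `D(R)` is
compactly generated. -/
theorem hrs_compactly_generated_of_gen_fp
    (T F : ModuleCat.{u} R → Prop) (htp : ModTorsionPair R T F)
    (V : ModuleCat.{u} R) (hV : Module.FinitePresentation R V)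
    (hT : ∀ M : ModuleCat.{u} R, T M ↔ GenBy R V M) :
    HRSCompactlyGenerated R T := by
  obtain ⟨S, hS, hS', hS₀, hSV⟩ := exists_presentation_complex.{w} V hV
  let r := (DerivedCategory.singleFunctor (ModuleCat.{u} R) (-1)).obj (ModuleCat.of R R)
  have hmem : ∀ s ∈ ({S, r} : Set (DerivedCategory (ModuleCat.{u} R))), s ∈ HRSAisle R T := by
    rintro s (rfl | rfl)
    · exact ⟨hS', (hT _).2 hS₀⟩
    · exact DerivedCategory.single_neg_one_mem_HRSAisle hT
  refine ⟨{S, r}, ?_, hmem, fun Y => ⟨fun hY s hs n hn => ?_, fun hY X hX f => ?_⟩⟩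
  · rintro s (rfl | rfl)
    · exact hS
    · exact isCompactObject_of_homSpannedByInj fun I Y c hc =>
        DerivedCategory.homSpannedByInj_single hc (-1) (ModuleCat.of R R)
  · exact hY _ (DerivedCategory.shift_mem_HRSAisle hT (hmem s hs) hn)
  · have : Y.IsGE 0 := DerivedCategory.isGE_zero_of_forall_hom_eq_zero (hY r (by simp))
    have : X.IsLE 0 := (DerivedCategory.isLE_iff X 0).2 hX.1
    refine DerivedCategory.eq_zero_of_isLE_of_isGE f 0
      (((hT _).1 hX.2).hom_eq_zero (hSV Y fun g => ?_) _)
    rw [← cancel_epi ((shiftFunctorZero (DerivedCategory (ModuleCat.{u} R)) ℤ).hom.app S),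
      comp_zero]
    exact hY S (by simp) 0 le_rfl _
end

section
/- Let R be an associative unital ring and let (𝒯,ℱ) be a hereditary torsion pair in R-Mod. Then (𝒯,ℱ) is tCG if and only if (𝒯,ℱ) is of finite type. -/
open CategoryTheory Limits DirectSum

universe w u

variable (R : Type u) [Ring R]

/-- The torsion pair `(T, F)` is tCG: there is a set of finitely presented modules in
the torsion class `T` whose simultaneous `Hom`-vanishing cuts out exactly the
torsion-free class `F`. -/
def IsTCGTorsionPair (T F : ModuleCat.{u} R → Prop) : Prop :=
  ∃ (Λ : Type u) (Tfam : Λ → ModuleCat.{u} R),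
    (∀ l, Module.FinitePresentation R (Tfam l)) ∧ (∀ l, T (Tfam l)) ∧
    ∀ M : ModuleCat.{u} R, F M ↔ ∀ (l : Λ) (f : Tfam l →ₗ[R] M), f = 0

/-- A class of modules is closed under direct limits (filtered colimits). -/
def ClosedUnderDirectLimits (F : ModuleCat.{u} R → Prop) : Prop :=
  ∀ (J : Type u) [SmallCategory J] [IsFiltered J] (D : J ⥤ ModuleCat.{u} R)
    (c : Cocone D), IsColimit c → (∀ j, F (D.obj j)) → F c.pt

/-- A class of modules is hereditary (closed under submodules). -/
def HereditaryClass (T : ModuleCat.{u} R → Prop) : Prop :=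
  ∀ M : ModuleCat.{u} R, T M → ∀ N : Submodule R M, T (ModuleCat.of R N)

section FilteredColimit

variable {R} {J : Type u} [SmallCategory J] [IsFiltered J] {D : J ⥤ ModuleCat.{u} R}
  {c : Cocone D}

/-- Finitely many elements of a filtered colimit of modules come from a common stage. -/
lemma exists_common_lift_of_isColimit (hc : IsColimit c) {ι : Type*} [Finite ι] (x : ι → c.pt) :
    ∃ (j : J) (y : ι → D.obj j), ∀ i, c.ι.app j (y i) = x i := by
  classical
  have := Fintype.ofFinite ι
  choose k z hz using fun i ↦ Concrete.isColimit_exists_rep D hc (x i)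
  obtain ⟨j, hj⟩ := IsFiltered.sup_objs_exists (Finset.univ.image k)
  have φ (i : ι) : k i ⟶ j := (hj (by simp)).some
  refine ⟨j, fun i ↦ D.map (φ i) (z i), fun i ↦ ?_⟩
  rw [← hz i, ← ConcreteCategory.comp_apply, c.w]

/-- Finitely many elements of a stage which vanish in a filtered colimit of modules vanish
simultaneously at a later stage. -/
lemma exists_common_map_eq_zero_of_isColimit (hc : IsColimit c) {ι : Type*} [Finite ι] {j : J}
    (y : ι → D.obj j) (hy : ∀ i, c.ι.app j (y i) = 0) :
    ∃ (k : J) (φ : j ⟶ k), ∀ i, D.map φ (y i) = 0 := by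
  classical
  have := Fintype.ofFinite ι
  suffices ∀ s : Finset ι, ∃ (k : J) (φ : j ⟶ k), ∀ i ∈ s, D.map φ (y i) = 0 by
    simpa using this Finset.univ
  intro s
  induction s using Finset.induction_on with
  | empty => exact ⟨j, 𝟙 j, by simp⟩
  | insert a s _ ih =>
    obtain ⟨k, φ, hφ⟩ := ih
    have ha : c.ι.app k (D.map φ (y a)) = c.ι.app k 0 := by
      rw [← ConcreteCategory.comp_apply, c.w, hy, map_zero]
    obtain ⟨l, ψ, hψ⟩ := (IsColimit.eq_iff' hc _ _).1 ha
    refine ⟨l, φ ≫ ψ, fun i hi ↦ ?_⟩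
    rw [D.map_comp, ConcreteCategory.comp_apply]
    rcases Finset.mem_insert.1 hi with rfl | hi
    · rw [hψ, map_zero]
    · rw [hφ i hi, map_zero]

/-- A linear map from a finitely presented module to a filtered colimit factors through
a stage. -/
lemma Module.FinitePresentation.exists_factor_of_isColimit (hc : IsColimit c) {P : Type*}
    [AddCommGroup P] [Module R P] [Module.FinitePresentation R P] (h : P →ₗ[R] c.pt) :
    ∃ (j : J) (g : P →ₗ[R] D.obj j), (c.ι.app j).hom ∘ₗ g = h := by
  obtain ⟨n, m, p, q, hp, hpq⟩ := Module.FinitePresentation.exists_fin' R P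
  obtain ⟨j, y, hy⟩ := exists_common_lift_of_isColimit hc
    (fun i ↦ h (p (Pi.basisFun R (Fin n) i)))
  let g := (Pi.basisFun R (Fin n)).constr ℕ y
  have hg : (c.ι.app j).hom ∘ₗ g = h ∘ₗ p :=
    (Pi.basisFun R (Fin n)).ext fun i ↦ by
      simpa only [LinearMap.comp_apply, g, Module.Basis.constr_basis] using hy i
  obtain ⟨k, φ, hφ⟩ := exists_common_map_eq_zero_of_isColimit hc
    (fun i ↦ g (q (Pi.basisFun R (Fin m) i))) fun i ↦ by
      have := LinearMap.congr_fun hg (q (Pi.basisFun R (Fin m) i))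
      rwa [LinearMap.comp_apply, LinearMap.comp_apply, hpq.apply_apply_eq_zero, map_zero] at this
  have hgq : ((D.map φ).hom ∘ₗ g) ∘ₗ q = 0 := (Pi.basisFun R (Fin m)).ext hφ
  have hker : LinearMap.ker p ≤ LinearMap.ker ((D.map φ).hom ∘ₗ g) := by
    rw [hpq.linearMap_ker_eq]
    exact LinearMap.range_le_ker_iff.2 hgq
  refine ⟨k, (LinearMap.ker p).liftQ _ hker ∘ₗ (p.quotKerEquivOfSurjective hp).symm, ?_⟩
  rw [← LinearMap.cancel_right hp, ← hg]
  refine LinearMap.ext fun v ↦ ?_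
  have hv : (p.quotKerEquivOfSurjective hp).symm (p v) = (LinearMap.ker p).mkQ v :=
    (LinearEquiv.symm_apply_eq _).2 rfl
  have hw := ConcreteCategory.congr_hom (c.w φ) (g v)
  simp only [LinearMap.comp_apply, LinearEquiv.coe_coe, hv, Submodule.mkQ_apply,
    Submodule.liftQ_apply]
  exact hw

end FilteredColimit

section QuotientColimit

variable {R} {M : Type u} [AddCommGroup M] [Module R M] {ι : Type u} [Preorder ι]

/-- The diagram of quotients of a module by an increasing family of submodules. -/
def quotientDiagram (K : ι →o Submodule R M) : ι ⥤ ModuleCat.{u} R where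
  obj i := ModuleCat.of R (M ⧸ K i)
  map f := ModuleCat.ofHom (Submodule.factor (K.monotone f.le))
  map_id i := by ext; rfl
  map_comp f g := by ext; rfl

/-- The quotient by the supremum, as a cocone over the diagram of quotients. -/
def quotientCocone (K : ι →o Submodule R M) : Cocone (quotientDiagram K) where
  pt := ModuleCat.of R (M ⧸ ⨆ i, K i)
  ι := { app i := ModuleCat.ofHom (Submodule.factor (le_iSup K i))
         naturality i j f := by
           ext x
           obtain ⟨x, rfl⟩ := (K i).mkQ_surjective x
           rfl }

/-- The quotient by a directed supremum is the colimit of the quotients. -/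
noncomputable def quotientCoconeIsColimit [IsDirectedOrder ι] [Nonempty ι]
    (K : ι →o Submodule R M) : IsColimit (quotientCocone K) :=
  have mk_eq (s : Cocone (quotientDiagram K)) {i j : ι} (h : i ≤ j) (x : M) :
      s.ι.app j ((K j).mkQ x) = s.ι.app i ((K i).mkQ x) :=
    ConcreteCategory.congr_hom (s.w (homOfLE h)) ((K i).mkQ x)
  have mk_eq' (s : Cocone (quotientDiagram K)) (i j : ι) (x : M) :
      s.ι.app j ((K j).mkQ x) = s.ι.app i ((K i).mkQ x) := by
    obtain ⟨k, hi, hj⟩ := exists_ge_ge i j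
    rw [← mk_eq s hi, ← mk_eq s hj]
  let i₀ : ι := Classical.arbitrary ι
  { desc s := ModuleCat.ofHom <| (⨆ i, K i).liftQ ((s.ι.app i₀).hom ∘ₗ (K i₀).mkQ) <|
      iSup_le fun i x hx ↦ by
        have h0 : (K i).mkQ x = 0 := (Submodule.Quotient.mk_eq_zero _).2 hx
        have := mk_eq' s i i₀ x
        rw [h0] at this
        exact this.trans (map_zero (s.ι.app i).hom)
    fac s j := by
      ext x
      obtain ⟨x, rfl⟩ := (K j).mkQ_surjective x
      exact mk_eq' s j i₀ x
    uniq s m hm := by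
      ext x
      obtain ⟨x, rfl⟩ := (⨆ i, K i).mkQ_surjective x
      exact ConcreteCategory.congr_hom (hm i₀) ((K i₀).mkQ x) }

end QuotientColimit

namespace ModTorsionPair

variable {R} {T F : ModuleCat.{u} R → Prop}

/-- If the torsion-free class is closed under direct limits, then every left ideal with
torsion quotient contains a finitely generated left ideal with torsion quotient. -/
lemma exists_fg_le_torsion_quotient (htp : ModTorsionPair R T F)
    (hF : ClosedUnderDirectLimits R F) (I : Submodule R R) (hI : T (ModuleCat.of R (R ⧸ I))) :
    ∃ J ≤ I, J.FG ∧ T (ModuleCat.of R (R ⧸ J)) := by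
  choose t ht hq using fun J : Submodule R R ↦
    htp.exists_torsion_submodule (ModuleCat.of R (R ⧸ J))
  let ι := {J : Submodule R R // J.FG ∧ J ≤ I}
  have : Nonempty ι := ⟨⟨⊥, Submodule.fg_bot, bot_le⟩⟩
  have : IsDirectedOrder ι := ⟨fun a b ↦
    ⟨⟨a.1 ⊔ b.1, a.2.1.sup b.2.1, sup_le a.2.2 b.2.2⟩, le_sup_left (a := a.1),
      le_sup_right (a := a.1)⟩⟩
  let K : ι →o Submodule R R :=
    { toFun J := LinearMap.ker ((t J.1).mkQ ∘ₗ J.1.mkQ)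
      monotone' J J' h x hx := by
        have hx' : J.1.mkQ x ∈ t J.1 := (Submodule.Quotient.mk_eq_zero _).1 hx
        have h0 := htp.hom_eq_zero (ht J.1) (hq J'.1)
          ((t J'.1).mkQ ∘ₗ Submodule.factor h ∘ₗ (t J.1).subtype)
        exact LinearMap.congr_fun h0 ⟨J.1.mkQ x, hx'⟩ }
  have hK : F (ModuleCat.of R (R ⧸ ⨆ J, K J)) :=
    hF ι (quotientDiagram K) _ (quotientCoconeIsColimit K) fun J ↦
      htp.iso_closed_torsionfree (LinearMap.quotKerEquivOfSurjective ((t J.1).mkQ ∘ₗ J.1.mkQ)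
        ((t J.1).mkQ_surjective.comp J.1.mkQ_surjective)).symm.toModuleIso (hq J.1)
  have hle : I ≤ ⨆ J, K J := fun x hx ↦ by
    let J : ι := ⟨R ∙ x, Submodule.fg_span_singleton x,
      (Submodule.span_singleton_le_iff_mem _ _).2 hx⟩
    refine le_iSup K J ?_
    have : J.1.mkQ x = 0 :=
      (Submodule.Quotient.mk_eq_zero _).2 (Submodule.mem_span_singleton_self x)
    exact LinearMap.mem_ker.2 (by rw [LinearMap.comp_apply, this, map_zero])
  have h1 : (1 : R) ∈ ⨆ J, K J :=
    (Submodule.Quotient.mk_eq_zero _).1 <|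
      LinearMap.congr_fun (htp.hom_eq_zero hI hK (Submodule.factor hle)) (I.mkQ 1)
  obtain ⟨J, hJ⟩ := (Submodule.mem_iSup_of_directed _ K.monotone.directed_le).1 h1
  have htop : t J.1 = ⊤ := by
    refine (Submodule.eq_top_iff').2 fun x ↦ ?_
    obtain ⟨r, rfl⟩ := J.1.mkQ_surjective x
    have := (K J).smul_mem r hJ
    rw [smul_eq_mul, mul_one] at this
    exact (Submodule.Quotient.mk_eq_zero _).1 this
  exact ⟨J.1, J.2.2, J.2.1,
    htp.iso_closed_torsion (LinearEquiv.ofTop (t J.1) htop).toModuleIso (ht J.1)⟩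

end ModTorsionPair

/-- The torsion-free class of a tCG torsion pair is closed under direct limits. -/
lemma IsTCGTorsionPair.closedUnderDirectLimits {T F : ModuleCat.{u} R → Prop}
    (h : IsTCGTorsionPair R T F) : ClosedUnderDirectLimits R F := by
  obtain ⟨Λ, P, hfp, -, hF⟩ := h
  intro J _ _ D c hc hD
  refine (hF _).2 fun l f ↦ ?_
  have := hfp l
  obtain ⟨j, g, rfl⟩ := Module.FinitePresentation.exists_factor_of_isColimit hc f
  rw [(hF _).1 (hD j) l g, LinearMap.comp_zero]

/-- A hereditary torsion pair of finite type is tCG. -/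
lemma ModTorsionPair.isTCG_of_closedUnderDirectLimits {T F : ModuleCat.{u} R → Prop}
    (htp : ModTorsionPair R T F) (hher : HereditaryClass R T)
    (hF : ClosedUnderDirectLimits R F) : IsTCGTorsionPair R T F := by
  refine ⟨{J : Submodule R R // J.FG ∧ T (ModuleCat.of R (R ⧸ J))},
    fun J ↦ ModuleCat.of R (R ⧸ J.1), fun J ↦ ?_, fun J ↦ J.2.2,
    fun M ↦ ⟨fun hM J f ↦ htp.hom_eq_zero J.2.2 hM f, fun hM ↦ ?_⟩⟩
  · exact Module.finitePresentation_of_surjective J.1.mkQ J.1.mkQ_surjective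
      (by simpa using J.2.1)
  obtain ⟨t, ht, hq⟩ := htp.exists_torsion_submodule M
  have hbot : t = ⊥ := by
    refine (Submodule.eq_bot_iff t).2 fun x hx ↦ ?_
    let f : R →ₗ[R] t := LinearMap.toSpanSingleton R t ⟨x, hx⟩
    have hI : T (ModuleCat.of R (R ⧸ LinearMap.ker f)) :=
      htp.iso_closed_torsion f.quotKerEquivRange.symm.toModuleIso (hher _ ht (LinearMap.range f))
    obtain ⟨J, hJI, hJ, hJT⟩ := htp.exists_fg_le_torsion_quotient hF _ hI
    have h0 := hM ⟨J, hJ, hJT⟩ (t.subtype ∘ₗ J.liftQ f hJI)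
    simpa [f] using LinearMap.congr_fun h0 (J.mkQ 1)
  exact htp.iso_closed_torsionfree (Submodule.quotEquivOfEqBot t hbot).toModuleIso hq

/-- **Corollary.** A hereditary torsion pair is tCG if and only if it is of finite
type. -/
theorem hereditary_isTCG_iff_finite_type (T F : ModuleCat.{u} R → Prop)
    (htp : ModTorsionPair R T F) (hher : HereditaryClass R T) :
    IsTCGTorsionPair R T F ↔ ClosedUnderDirectLimits R F :=
  ⟨fun h ↦ h.closedUnderDirectLimits,
    fun h ↦ htp.isTCG_of_closedUnderDirectLimits R hher h⟩
end

section
/- Let R be an associative unital ring and let (𝒯,ℱ) be a torsion pair in R-Mod of finite type. Then there exists a set {T_λ}_{λ∈Λ} of finitely presented left R-modules with T_λ ∈ 𝒯 for all λ such that ℱ = {M : Hom_R(T_λ, M) = 0 for all λ ∈ Λ} if and only if there exists a set {T'_μ}_{μ∈M} of finitely generated left R-modules with T'_μ ∈ 𝒯 for all μ such that ℱ = {M : Hom_R(T'_μ, M) = 0 for all μ ∈ M}. -/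
open CategoryTheory Limits DirectSum

universe w u

variable (R : Type u) [Ring R]

variable {R}

section

variable {A : Type u} [AddCommGroup A] [Module R A]

/-- For `N ≤ A`, the preimage `L` in `A` of the torsion submodule of `A ⧸ N`. -/
theorem ModTorsionPair.exists_le_torsion_closure {T F : ModuleCat.{u} R → Prop}
    (htp : ModTorsionPair R T F) (N : Submodule R A) :
    ∃ L : Submodule R A, N ≤ L ∧ F (ModuleCat.of R (A ⧸ L)) ∧
      (∀ L' : Submodule R A, F (ModuleCat.of R (A ⧸ L')) → N ≤ L' → L ≤ L') ∧
      (L = ⊤ → T (ModuleCat.of R (A ⧸ N))) := by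
  obtain ⟨t, ht, hq⟩ := htp.exists_torsion_submodule (ModuleCat.of R (A ⧸ N))
  let t' : Submodule R (A ⧸ N) := t
  let g : A →ₗ[R] (A ⧸ N) ⧸ t' := t'.mkQ ∘ₗ N.mkQ
  have hg : Function.Surjective g := t'.mkQ_surjective.comp N.mkQ_surjective
  have hker : ∀ x, x ∈ LinearMap.ker g ↔ N.mkQ x ∈ t' := fun x ↦
    LinearMap.mem_ker.trans (Submodule.Quotient.mk_eq_zero t')
  refine ⟨LinearMap.ker g, fun x hx ↦ ?_, ?_, fun L' hL' hN x hx ↦ ?_, fun htop ↦ ?_⟩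
  · rw [hker, Submodule.mkQ_apply, (Submodule.Quotient.mk_eq_zero N).mpr hx]
    exact t'.zero_mem
  · exact htp.iso_closed_torsionfree (g.quotKerEquivOfSurjective hg).symm.toModuleIso hq
  · have h0 := htp.hom_eq_zero ht hL' (Submodule.factor hN ∘ₗ t'.subtype)
    have hx0 : L'.mkQ x = 0 := LinearMap.congr_fun h0 ⟨N.mkQ x, (hker x).mp hx⟩
    exact (Submodule.Quotient.mk_eq_zero L').mp hx0
  · have ht' : t' = ⊤ := by
      refine eq_top_iff.mpr fun y _ ↦ ?_
      obtain ⟨x, rfl⟩ := N.mkQ_surjective y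
      exact (hker x).mp (htop ▸ Submodule.mem_top)
    exact htp.iso_closed_torsion (LinearEquiv.ofTop t' ht').toModuleIso ht

/-- The quotient of `A` by the supremum of a directed family of submodules is the direct limit
of the quotients by the members of the family. -/
theorem ClosedUnderDirectLimits.quotient_iSup {F : ModuleCat.{u} R → Prop}
    (hft : ClosedUnderDirectLimits R F) {J : Type u} [Preorder J] [IsDirectedOrder J] [Nonempty J]
    (L : J →o Submodule R A) (hL : ∀ j, F (ModuleCat.of R (A ⧸ L j))) :
    F (ModuleCat.of R (A ⧸ ⨆ j, L j)) := by
  let D : J ⥤ ModuleCat.{u} R :=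
    { obj := fun j ↦ ModuleCat.of R (A ⧸ L j)
      map := fun f ↦ ModuleCat.ofHom (Submodule.factor (L.monotone (leOfHom f)))
      map_id := fun j ↦ by
        ext x
        rfl
      map_comp := fun f g ↦ by
        ext x
        rfl }
  let c : Cocone D :=
    { pt := ModuleCat.of R (A ⧸ ⨆ j, L j)
      ι :=
        { app := fun j ↦ ModuleCat.ofHom (Submodule.factor (le_iSup L j))
          naturality := fun i j f ↦ by
            ext x
            rfl } }
  have key : ∀ (s : Cocone D) (i j : J) (x : A),
      (s.ι.app i).hom ((L i).mkQ x) = (s.ι.app j).hom ((L j).mkQ x) := by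
    intro s i j x
    obtain ⟨k, hik, hjk⟩ := exists_ge_ge i j
    have e : ∀ (l : J) (hl : l ≤ k),
        (s.ι.app k).hom ((L k).mkQ x) = (s.ι.app l).hom ((L l).mkQ x) := fun l hl ↦
      LinearMap.congr_fun (congrArg ModuleCat.Hom.hom (s.w (homOfLE hl))) ((L l).mkQ x)
    rw [← e i hik, e j hjk]
  let j₀ : J := Classical.arbitrary J
  let d : ∀ s : Cocone D, (A ⧸ ⨆ j, L j) →ₗ[R] s.pt := fun s ↦
    (⨆ j, L j).liftQ ((s.ι.app j₀).hom ∘ₗ (L j₀).mkQ) <| iSup_le fun j x hx ↦ by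
      refine LinearMap.mem_ker.mpr ((key s j₀ j x).trans ?_)
      rw [Submodule.mkQ_apply, (Submodule.Quotient.mk_eq_zero (L j)).mpr hx]
      exact map_zero _
  refine hft J D c
    { desc := fun s ↦ ModuleCat.ofHom (d s)
      fac := fun s j ↦ ?_
      uniq := fun s m hm ↦ ?_ } hL
  · ext x
    exact key s j₀ j x
  · ext x
    exact LinearMap.congr_fun (congrArg ModuleCat.Hom.hom (hm j₀)) ((L j₀).mkQ x)

end

/-- For a torsion pair of finite type, every finitely generated torsion module is a quotient of
a finitely presented torsion module. -/
theorem ModTorsionPair.exists_finitePresentation_surjective {T F : ModuleCat.{u} R → Prop}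
    (htp : ModTorsionPair R T F) (hft : ClosedUnderDirectLimits R F)
    (M : ModuleCat.{u} R) [Module.Finite R M] (hM : T M) :
    ∃ P : ModuleCat.{u} R, Module.FinitePresentation R P ∧ T P ∧
      ∃ g : P →ₗ[R] M, Function.Surjective g := by
  obtain ⟨n, f, hf⟩ := Module.Finite.exists_fin' R M
  let J : Type u := {N : Submodule R (Fin n → R) // N.FG ∧ N ≤ LinearMap.ker f}
  have : Nonempty J := ⟨⟨⊥, Submodule.fg_bot, bot_le⟩⟩
  have : IsDirectedOrder J := ⟨fun N₁ N₂ ↦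
    ⟨⟨N₁.1 ⊔ N₂.1, N₁.2.1.sup N₂.2.1, sup_le N₁.2.2 N₂.2.2⟩,
      le_sup_left (a := N₁.1), le_sup_right (a := N₁.1)⟩⟩
  choose L hle hF hmin htop using fun N : J ↦ htp.exists_le_torsion_closure N.1
  have hmono : Monotone L := fun N₁ N₂ h ↦ hmin N₁ (L N₂) (hF N₂) (le_trans h (hle N₂))
  have hker : LinearMap.ker f ≤ ⨆ N, L N := fun x hx ↦ by
    have hx' : Submodule.span R {x} ≤ LinearMap.ker f := by simpa using hx
    exact le_iSup L ⟨Submodule.span R {x}, Submodule.fg_span_singleton x, hx'⟩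
      (hle _ (Submodule.mem_span_singleton_self x))
  have hsup : ⨆ N, L N = ⊤ := by
    have h0 := htp.hom_eq_zero hM (hft.quotient_iSup ⟨L, hmono⟩ hF)
      (Submodule.factor hker ∘ₗ (f.quotKerEquivOfSurjective hf).symm.toLinearMap)
    refine eq_top_iff.mpr fun x _ ↦ (Submodule.Quotient.mk_eq_zero _).mp ?_
    have hx := LinearMap.congr_fun h0 (f.quotKerEquivOfSurjective hf ((LinearMap.ker f).mkQ x))
    simp only [LinearMap.comp_apply, LinearEquiv.coe_coe] at hx
    erw [LinearEquiv.symm_apply_apply] at hx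
    exact hx
  obtain ⟨_, ⟨N, rfl⟩, hN⟩ :=
    (CompleteLattice.isCompactElement_iff_le_of_directed_sSup_le _ _).mp
      ((Submodule.fg_iff_compact _).mp (Module.Finite.fg_top (R := R) (M := Fin n → R)))
      (Set.range L) (Set.range_nonempty L) (directedOn_range.mpr hmono.directed_le) hsup.ge
  refine ⟨ModuleCat.of R ((Fin n → R) ⧸ N.1),
    Module.finitePresentation_of_surjective N.1.mkQ N.1.mkQ_surjective ?_,
    htop N (top_le_iff.mp hN), N.1.liftQ f N.2.2, fun y ↦ ?_⟩
  · rw [Submodule.ker_mkQ]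
    exact N.2.1
  · obtain ⟨x, rfl⟩ := hf y
    exact ⟨N.1.mkQ x, rfl⟩

variable (R)

/-- **Corollary.** For a torsion pair of finite type, the torsion-free class is cut out
by a set of finitely presented modules in `T` if and only if it is cut out by a set of
finitely generated modules in `T`. -/
theorem finite_type_fp_iff_fg (T F : ModuleCat.{u} R → Prop)
    (htp : ModTorsionPair R T F) (hft : ClosedUnderDirectLimits R F) :
    (∃ (Λ : Type u) (Tfam : Λ → ModuleCat.{u} R),
        (∀ l, Module.FinitePresentation R (Tfam l)) ∧ (∀ l, T (Tfam l)) ∧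
        ∀ M : ModuleCat.{u} R, F M ↔ ∀ (l : Λ) (f : Tfam l →ₗ[R] M), f = 0) ↔
      (∃ (Λ' : Type u) (Tfam' : Λ' → ModuleCat.{u} R),
        (∀ l, Module.Finite R (Tfam' l)) ∧ (∀ l, T (Tfam' l)) ∧
        ∀ M : ModuleCat.{u} R, F M ↔ ∀ (l : Λ') (f : Tfam' l →ₗ[R] M), f = 0) := by
  constructor
  · rintro ⟨Λ, P, hfp, hT, hF⟩
    exact ⟨Λ, P, fun l ↦ have := hfp l; inferInstance, hT, hF⟩
  · rintro ⟨Λ, Q, hfg, hT, hF⟩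
    choose P hP hPT g hg using fun l ↦
      have := hfg l
      htp.exists_finitePresentation_surjective hft (Q l) (hT l)
    refine ⟨Λ, P, hP, hPT, fun M ↦ ⟨fun hM l f ↦ htp.hom_eq_zero (hPT l) hM f, fun h ↦ ?_⟩⟩
    refine (hF M).mpr fun l f ↦ LinearMap.ext fun y ↦ ?_
    obtain ⟨x, rfl⟩ := hg l y
    exact LinearMap.congr_fun (h l (f ∘ₗ g l)) x
end
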